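/- For every integer n ≥ 6, the maximum number of triples in a Berge-K4-free triple system on an n-element vertex set equals f(n) = ⌊n/3⌋·⌊(n+1)/3⌋·⌊(n+2)/3⌋; that is, every Berge-K4-free triple system on n vertices has at most f(n) triples, and there exists a Berge-K4-free triple system on n vertices with exactly f(n) triples. -/

import Mathlib

/-- `HasBergeK4 H` : `H` contains a Berge-`K₄`, i.e. four distinct vertices
`v₁, v₂, v₃, v₄` and six pairwise distinct triples `e_{ij} ∈ H` with
`{vᵢ, vⱼ} ⊆ e_{ij}` for every `1 ≤ i < j ≤ 4`. -/
def HasBergeK4 {V : Type*} [DecidableEq V] (H : Finset (Finset V)) : Prop :=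
  ∃ v₁ v₂ v₃ v₄ : V, ∃ e₁₂ e₁₃ e₁₄ e₂₃ e₂₄ e₃₄ : Finset V,
    v₁ ≠ v₂ ∧ v₁ ≠ v₃ ∧ v₁ ≠ v₄ ∧ v₂ ≠ v₃ ∧ v₂ ≠ v₄ ∧ v₃ ≠ v₄ ∧
    ([e₁₂, e₁₃, e₁₄, e₂₃, e₂₄, e₃₄] : List (Finset V)).Nodup ∧
    e₁₂ ∈ H ∧ e₁₃ ∈ H ∧ e₁₄ ∈ H ∧ e₂₃ ∈ H ∧ e₂₄ ∈ H ∧ e₃₄ ∈ H ∧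
    {v₁, v₂} ⊆ e₁₂ ∧ {v₁, v₃} ⊆ e₁₃ ∧ {v₁, v₄} ⊆ e₁₄ ∧
    {v₂, v₃} ⊆ e₂₃ ∧ {v₂, v₄} ⊆ e₂₄ ∧ {v₃, v₄} ⊆ e₃₄

/-- Four vertices of `{0, …, 7}` together with the bit masks used to look for a Berge-`K₄` on them.
Bit `x` of a mask stands for the `x`-th triple in colexicographic order. -/
structure Quad where
  /-- The first triple containing the largest of the four vertices. -/
  start : ℕ
  /-- The triples containing at least two of the four vertices. -/
  touch : ℕ
  vertices : Fin 8 × Fin 8 × Fin 8 × Fin 8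
  /-- For each of the six pairs, the mask of the triples meeting the four vertices exactly in that
  pair, followed by the two single triples inside the four vertices that contain the pair. -/
  pairs : List (ℕ × ℕ × ℕ)

/-- Greedy search for distinct representatives, one for each row, inside the mask `a`. -/
noncomputable def hasReps (l : List (ℕ × ℕ × ℕ)) : ℕ → Bool :=
  l.rec (fun _ => true) fun r _ ih a =>
    bif Nat.beq (Nat.land a r.1) 0 then
      (bif Nat.beq (Nat.land a r.2.1) 0 then false else ih (Nat.xor a r.2.1)) ||
      (bif Nat.beq (Nat.land a r.2.2) 0 then false else ih (Nat.xor a r.2.2))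
    else ih a

/-- The rows of the quadruples that may become a Berge-`K₄` when the `d`-th triple is added to a
set of earlier triples. -/
def touching (d : ℕ) : List Quad → List (List (ℕ × ℕ × ℕ))
  | [] => []
  | K :: l =>
    bif Nat.ble K.start d then
      bif Nat.beq (Nat.land (Nat.pow 2 d) K.touch) 0 then touching d l else K.pairs :: touching d l
    else []

/-- The first `d` bits of `a` show that permuting the bits makes `a` lexicographically larger. -/
noncomputable def lexSmaller (d a : ℕ) (l : List (ℕ × ℕ)) : Bool :=
  l.rec false fun r _ ih =>
    bif Nat.ble d r.1 then false else bif Nat.ble d r.2 then false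
    else bif Nat.beq (Nat.land a (Nat.pow 2 r.1)) 0 then
      bif Nat.beq (Nat.land a (Nat.pow 2 r.2)) 0 then ih else true
    else bif Nat.beq (Nat.land a (Nat.pow 2 r.2)) 0 then false else ih

/-- Some requirement `(e, s)`, of having `s` elements among the first `e`, is out of reach for sets
with `c` elements among the first `d`. -/
def tooFew (d c : ℕ) : List (ℕ × ℕ) → Bool
  | [] => false
  | (e, s) :: l => (Nat.ble d e && Nat.blt (Nat.add c (Nat.sub e d)) s) || tooFew d c l

/-- Exhaustive search, deciding the last `k` of the first `N` triples, where the mask `a` with `c`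
elements describes the previous decisions. The result `true` means that all branches are
contradictory. -/
noncomputable def refuted (qt : List Quad) (tt : List (List (ℕ × ℕ))) (req : List (ℕ × ℕ))
    (N k : ℕ) : ℕ → ℕ → Bool :=
  k.rec (fun c _ => tooFew N c req) fun k ih c a =>
    tooFew (Nat.sub N (Nat.succ k)) c req ||
    (Nat.ble (Nat.sub N (Nat.succ k)) 20 && tt.any (lexSmaller (Nat.sub N (Nat.succ k)) a)) ||
    ((touching (Nat.sub N (Nat.succ k)) qt).any
        (hasReps · (Nat.lor a (Nat.pow 2 (Nat.sub N (Nat.succ k))))) ||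
      ih (Nat.succ c) (Nat.lor a (Nat.pow 2 (Nat.sub N (Nat.succ k))))) &&
    ih c a

/-- All quadruples of vertices of `{0, …, 7}`. -/
def quadTable : List Quad :=
  [⟨1, 2164729643007, (0, 1, 2, 3),
    [(274886303872, 2, 4), (549772607744, 2, 8), (1099545215488, 4, 8), (68721575968, 1, 4),
     (137443151936, 1, 8), (34360787984, 1, 2)]⟩,
   ⟨4, 15634158526463, (0, 1, 2, 4),
    [(2199090430080, 16, 32), (4398180860160, 16, 64), (8796361720320, 32, 64),
     (68721575940, 1, 32), (137443151880, 1, 64), (34360787970, 1, 16)]⟩,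
   ⟨4, 25049014429695, (0, 1, 3, 4),
    [(2199090429984, 16, 128), (4398180859968, 16, 256), (17592723440128, 128, 256),
     (274886303748, 2, 128), (549772607496, 2, 256), (34360787969, 2, 16)]⟩,
   ⟨4, 30031328685055, (0, 2, 3, 4),
    [(2199090429968, 32, 128), (8796361719872, 32, 512), (17592723439872, 128, 512),
     (274886303746, 4, 128), (1099545214984, 4, 512), (68721575937, 4, 32)]⟩,
   ⟨4, 32574026994687, (1, 2, 3, 4),
    [(4398180859920, 64, 256), (8796361719840, 64, 512), (17592723439744, 256, 512),
     (549772607490, 8, 256), (1099545214980, 8, 512), (137443151873, 8, 64)]⟩,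
   ⟨10, 246538646846591, (0, 1, 2, 5),
    [(35185445904384, 1024, 2048), (70370891808768, 1024, 4096), (140741783617536, 2048, 4096),
     (68721573924, 1, 2048), (137443147848, 1, 4096), (34360786962, 1, 1024)]⟩,
   ⟨10, 387898924596639, (0, 1, 3, 5),
    [(35185445898240, 1024, 8192), (70370891796480, 1024, 16384), (281483567202304, 8192, 16384),
     (274886295684, 2, 8192), (549772591368, 2, 16384), (34360786961, 2, 1024)]⟩,
   ⟨10, 458853949767343, (0, 2, 3, 5),
    [(35185445897216, 2048, 8192), (140741783588864, 2048, 32768), (281483567185920, 8192, 32768),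
     (274886295682, 4, 8192), (1099545182728, 4, 32768), (68721573921, 4, 2048)]⟩,
   ⟨10, 494383003533135, (1, 2, 3, 5),
    [(70370891793408, 4096, 16384), (140741783586816, 4096, 32768), (281483567177728, 16384, 32768),
     (549772591362, 8, 16384), (1099545182724, 8, 32768), (137443147841, 8, 4096)]⟩,
   ⟨10, 675155103677939, (0, 1, 4, 5),
    [(35185445840896, 1024, 65536), (70370891681792, 1024, 131072),
     (562967134076928, 65536, 131072), (2199090364576, 16, 65536), (4398180729152, 16, 131072),
     (34360786947, 16, 1024)]⟩,
   ⟨10, 749958536871669, (0, 2, 4, 5),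
    [(35185445839872, 2048, 65536), (140741783359488, 2048, 262144),
     (562967133945856, 65536, 262144), (2199090364560, 32, 65536), (8796361458240, 32, 262144),
     (68721573893, 32, 2048)]⟩,
   ⟨10, 787411794648953, (1, 2, 4, 5),
    [(70370891678720, 4096, 131072), (140741783357440, 4096, 262144),
     (562967133880320, 131072, 262144), (4398180729104, 64, 131072), (8796361458208, 64, 262144),
     (137443147785, 64, 4096)]⟩,
   ⟨10, 899702846386102, (0, 3, 4, 5),
    [(35185445833728, 8192, 65536), (281483566694400, 8192, 524288),
     (562967133683712, 65536, 524288), (2199090364464, 128, 65536), (17592722916096, 128, 524288),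
     (274886295558, 128, 8192)]⟩,
   ⟨10, 937362268878810, (1, 3, 4, 5),
    [(70370891666432, 16384, 131072), (281483566686208, 16384, 524288),
     (562967133618176, 131072, 524288), (4398180728912, 256, 131072), (17592722915968, 256, 524288),
     (549772591114, 256, 16384)]⟩,
   ⟨10, 1012681113861100, (2, 3, 4, 5),
    [(140741783328768, 32768, 262144), (281483566669824, 32768, 524288),
     (562967133487104, 262144, 524288), (8796361457760, 512, 262144), (17592722915712, 512, 524288),
     (1099545182220, 512, 32768)]⟩,
   ⟨20, 7881547918089343, (0, 1, 2, 6),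
    [(1125901056081920, 1048576, 2097152), (2251802112163840, 1048576, 4194304),
     (4503604224327680, 2097152, 4194304), (68719478820, 1, 2097152), (137438957640, 1, 4194304),
     (34359739410, 1, 1048576)]⟩,
   ⟨20, 12385770584171935, (0, 1, 3, 6),
    [(1125901049790464, 1048576, 8388608), (2251802099580928, 1048576, 16777216),
     (9007208415100928, 8388608, 16777216), (274877915268, 2, 8388608), (549755830536, 2, 16777216),
     (34359739409, 2, 1048576)]⟩,
   ⟨20, 14638156795128495, (0, 2, 3, 6),
    [(1125901048741888, 2097152, 8388608), (4503604194967552, 2097152, 33554432),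
     (9007208398323712, 8388608, 33554432), (274877915266, 4, 8388608),
     (1099511661064, 4, 33554432), (68719478817, 4, 2097152)]⟩,
   ⟨20, 15764401440215887, (1, 2, 3, 6),
    [(2251802096435200, 4194304, 16777216), (4503604192870400, 4194304, 33554432),
     (9007208389935104, 16777216, 33554432), (549755830530, 8, 16777216),
     (1099511661060, 8, 33554432), (137438957633, 8, 4194304)]⟩,
   ⟨20, 21398751099946483, (0, 1, 4, 6),
    [(1125900991070208, 1048576, 67108864), (2251801982140416, 1048576, 134217728),
     (18014416494657536, 67108864, 134217728), (2199023321248, 16, 67108864),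
     (4398046642496, 16, 134217728), (34359739395, 16, 1048576)]⟩,
   ⟨20, 23654985484274421, (0, 2, 4, 6),
    [(1125900990021632, 2097152, 67108864), (4503603960086528, 2097152, 268435456),
     (18014416360439808, 67108864, 268435456), (2199023321232, 32, 67108864),
     (8796093284928, 32, 268435456), (68719478789, 32, 2097152)]⟩,
   ⟨20, 24783154216047481, (1, 2, 4, 6),
    [(2251801978994688, 4194304, 134217728), (4503603957989376, 4194304, 268435456),
     (18014416293330944, 134217728, 268435456), (4398046642448, 64, 134217728),
     (8796093284896, 64, 268435456), (137438957577, 64, 4194304)]⟩,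
   ⟨20, 28167591670916022, (0, 3, 4, 6),
    [(1125900983730176, 8388608, 67108864), (9007207895007232, 8388608, 536870912),
     (18014416092004352, 67108864, 536870912), (2199023321136, 128, 67108864),
     (17592186569472, 128, 536870912), (274877915142, 128, 8388608)]⟩,
   ⟨20, 29295966554833882, (1, 3, 4, 6),
    [(2251801966411776, 16777216, 134217728), (9007207886618624, 16777216, 536870912),
     (18014416024895488, 134217728, 536870912), (4398046642256, 256, 134217728),
     (17592186569344, 256, 536870912), (549755830282, 256, 16777216)]⟩,
   ⟨20, 31552716319523820, (2, 3, 4, 6),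
    [(4503603928629248, 33554432, 268435456), (9007207869841408, 33554432, 536870912),
     (18014415890677760, 268435456, 536870912), (8796093284448, 512, 268435456),
     (17592186569088, 512, 536870912), (1099511660556, 512, 33554432)]⟩,
   ⟨20, 39512117735554067, (0, 1, 5, 6),
    [(1125899984437248, 1048576, 1073741824), (2251799968874496, 1048576, 2147483648),
     (36028827083735040, 1073741824, 2147483648), (35184372164608, 1024, 1073741824),
     (70368744329216, 1024, 2147483648), (34359738387, 1024, 1048576)]⟩,
   ⟨20, 41834320804297765, (0, 2, 5, 6),
    [(1125899983388672, 2097152, 1073741824), (4503599933554688, 2097152, 4294967296),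
     (36028824936251392, 1073741824, 4294967296), (35184372163584, 2048, 1073741824),
     (140737488654336, 2048, 4294967296), (68719476773, 2048, 2097152)]⟩,
   ⟨20, 42995473878277193, (1, 2, 5, 6),
    [(2251799965728768, 4194304, 2147483648), (4503599931457536, 4194304, 4294967296),
     (36028823862509568, 2147483648, 4294967296), (70368744326144, 4096, 2147483648),
     (140737488652288, 4096, 4294967296), (137438953545, 4096, 4194304)]⟩,
   ⟨20, 46478864359746694, (0, 3, 5, 6),
    [(1125899977097216, 8388608, 1073741824), (9007199841943552, 8388608, 8589934592),
     (36028820641284096, 1073741824, 8589934592), (35184372157440, 8192, 1073741824),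
     (281474977284096, 8192, 8589934592), (274877907078, 8192, 8388608)]⟩,
   ⟨20, 47640223585858826, (1, 3, 5, 6),
    [(2251799953145856, 16777216, 2147483648), (9007199833554944, 16777216, 8589934592),
     (36028819567542272, 2147483648, 8589934592), (70368744313856, 16384, 2147483648),
     (281474977275904, 16384, 8589934592), (549755814154, 16384, 16777216)]⟩,
   ⟨20, 49962942034934284, (2, 3, 5, 6),
    [(4503599902097408, 33554432, 4294967296), (9007199816777728, 33554432, 8589934592),
     (36028817420058624, 4294967296, 8589934592), (140737488623616, 32768, 4294967296),
     (281474977259520, 32768, 8589934592), (1099511628300, 32768, 33554432)]⟩,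
   ⟨20, 55769463089212592, (0, 4, 5, 6),
    [(1125899918376960, 67108864, 1073741824), (18014399449006080, 67108864, 17179869184),
     (36028812051349504, 1073741824, 17179869184), (35184372100096, 65536, 1073741824),
     (562949954338816, 65536, 17179869184), (2199023255728, 65536, 67108864)]⟩,
   ⟨20, 56932746401895760, (1, 4, 5, 6),
    [(2251799835705344, 134217728, 2147483648), (18014399381897216, 134217728, 17179869184),
     (36028810977607680, 2147483648, 17179869184), (70368744199168, 131072, 2147483648),
     (562949954273280, 131072, 17179869184), (4398046511440, 131072, 134217728)]⟩,
   ⟨20, 59259313024113248, (2, 4, 5, 6),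
    [(4503599667216384, 268435456, 4294967296), (18014399247679488, 268435456, 17179869184),
     (36028808830124032, 4294967296, 17179869184), (140737488394240, 262144, 4294967296),
     (562949954142208, 262144, 17179869184), (8796093022816, 262144, 268435456)]⟩,
   ⟨20, 63912446251754368, (3, 4, 5, 6),
    [(9007199313461248, 536870912, 8589934592), (18014398979244032, 536870912, 17179869184),
     (36028804535156736, 8589934592, 17179869184), (281474976768000, 524288, 8589934592),
     (562949953880064, 524288, 17179869184), (17592186045312, 524288, 536870912)]⟩,
   ⟨35, 8145147786173567, (0, 1, 2, 7),
    [(1163558180093952, 34359738368, 68719476736), (2327116360187904, 34359738368, 137438953472),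
     (4654232720375808, 68719476736, 137438953472), (2099236, 1, 68719476736),
     (4198472, 1, 137438953472), (1049618, 1, 34359738368)]⟩,
   ⟨35, 12798281013814687, (0, 1, 3, 7),
    [(1163352021663744, 34359738368, 274877906944), (2326704043327488, 34359738368, 549755813888),
     (9307365929123840, 274877906944, 549755813888), (8396932, 2, 274877906944),
     (16793864, 2, 549755813888), (1049617, 2, 34359738368)]⟩,
   ⟨35, 15124847636032175, (0, 2, 3, 7),
    [(1163317661925376, 68719476736, 274877906944), (4653270647701504, 68719476736, 1099511627776),
     (9306816173309952, 274877906944, 1099511627776), (8396930, 4, 274877906944),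
     (33587720, 4, 1099511627776), (2099233, 4, 68719476736)]⟩,
   ⟨35, 16288130948715343, (1, 2, 3, 7),
    [(2326600964112384, 137438953472, 549755813888),
     (4653201928224768, 137438953472, 1099511627776),
     (9306541295403008, 549755813888, 1099511627776), (16793858, 8, 549755813888),
     (33587716, 8, 1099511627776), (4198465, 8, 137438953472)]⟩,
   ⟨35, 22094652002993651, (0, 1, 4, 7),
    [(1161427876315136, 34359738368, 2199023255552), (2322855752630272, 34359738368, 4398046511104),
     (18603736741969920, 2199023255552, 4398046511104), (67174560, 16, 2199023255552),
     (134349120, 16, 4398046511104), (1049603, 16, 34359738368)]⟩,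
   ⟨35, 24417370452069109, (0, 2, 4, 7),
    [(1161393516576768, 68719476736, 2199023255552), (4645574066307072, 68719476736, 8796093022208),
     (18599338695458816, 2199023255552, 8796093022208), (67174544, 32, 2199023255552),
     (268698176, 32, 8796093022208), (2099205, 32, 68719476736)]⟩,
   ⟨35, 25578729678181241, (1, 2, 4, 7),
    [(2322752673415168, 137438953472, 4398046511104),
     (4645505346830336, 137438953472, 8796093022208),
     (18597139672203264, 4398046511104, 8796093022208), (134349072, 64, 4398046511104),
     (268698144, 64, 8796093022208), (4198409, 64, 137438953472)]⟩,
   ⟨35, 29062120159650742, (0, 3, 4, 7),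
    [(1161187358146560, 274877906944, 2199023255552),
     (9290323498893312, 274877906944, 17592186044416),
     (18590542602436608, 2199023255552, 17592186044416), (67174448, 128, 2199023255552),
     (537395968, 128, 17592186044416), (8396806, 128, 274877906944)]⟩,
   ⟨35, 30223273233630170, (1, 3, 4, 7),
    [(2322340356554752, 549755813888, 4398046511104),
     (9290048620986368, 549755813888, 17592186044416),
     (18588343579181056, 4398046511104, 17592186044416), (134348880, 256, 4398046511104),
     (537395840, 256, 17592186044416), (16793610, 256, 549755813888)]⟩,
   ⟨35, 32545476302373868, (2, 3, 4, 7),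
    [(4644543274156032, 1099511627776, 8796093022208),
     (9289498865172480, 1099511627776, 17592186044416),
     (18583945532669952, 8796093022208, 17592186044416), (268697696, 512, 8796093022208),
     (537395584, 512, 17592186044416), (33587212, 512, 1099511627776)]⟩,
   ⟨35, 40504877718404115, (0, 1, 5, 7),
    [(1128442527481856, 34359738368, 35184372088832),
     (2256885054963712, 34359738368, 70368744177664),
     (37013959437451264, 35184372088832, 70368744177664), (1073817600, 1024, 35184372088832),
     (2147635200, 1024, 70368744177664), (1048595, 1024, 34359738368)]⟩,
   ⟨35, 42761627483094053, (0, 2, 5, 7),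
    [(1128408167743488, 68719476736, 35184372088832),
     (4513632670973952, 68719476736, 140737488355328),
     (36943590693273600, 35184372088832, 140737488355328), (1073816576, 2048, 35184372088832),
     (4295266304, 2048, 140737488355328), (2097189, 2048, 68719476736)]⟩,
   ⟨35, 43890002367011913, (1, 2, 5, 7),
    [(2256781975748608, 137438953472, 70368744177664),
     (4513563951497216, 137438953472, 140737488355328),
     (36908406321184768, 70368744177664, 140737488355328), (2147632128, 4096, 70368744177664),
     (4295264256, 4096, 140737488355328), (4194377, 4096, 137438953472)]⟩,
   ⟨35, 47274439821880454, (0, 3, 5, 7),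
    [(1128202009313280, 274877906944, 35184372088832),
     (9026440708227072, 274877906944, 281474976710656),
     (36802853204918272, 35184372088832, 281474976710656), (1073810432, 8192, 35184372088832),
     (8590508032, 8192, 281474976710656), (8388742, 8192, 274877906944)]⟩,
   ⟨35, 48402608553653514, (1, 3, 5, 7),
    [(2256369658888192, 549755813888, 70368744177664),
     (9026165830320128, 549755813888, 281474976710656),
     (36767668832829440, 70368744177664, 281474976710656), (2147619840, 16384, 70368744177664),
     (8590499840, 16384, 281474976710656), (16777482, 16384, 549755813888)]⟩,
   ⟨35, 50658842937981452, (2, 3, 5, 7),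
    [(4512601878822912, 1099511627776, 140737488355328),
     (9025616074506240, 1099511627776, 281474976710656),
     (36697300088651776, 140737488355328, 281474976710656), (4295235584, 32768, 140737488355328),
     (8590483456, 32768, 281474976710656), (33554956, 32768, 1099511627776)]⟩,
   ⟨35, 56293192597712048, (0, 4, 5, 7),
    [(1126277863964672, 2199023255552, 35184372088832),
     (18045184835059712, 2199023255552, 562949953421312),
     (36521378228207616, 35184372088832, 562949953421312), (1073753088, 65536, 35184372088832),
     (17180786688, 65536, 562949953421312), (67109040, 65536, 2199023255552)]⟩,
   ⟨35, 57419437242799440, (1, 4, 5, 7),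
    [(2252521368190976, 4398046511104, 70368744177664),
     (18042985811804160, 4398046511104, 562949953421312),
     (36486193856118784, 70368744177664, 562949953421312), (2147505152, 131072, 70368744177664),
     (17180721152, 131072, 562949953421312), (134218064, 131072, 4398046511104)]⟩,
   ⟨35, 59671823453756000, (2, 4, 5, 7),
    [(4504905297428480, 8796093022208, 140737488355328),
     (18038587765293056, 8796093022208, 562949953421312),
     (36415825111941120, 140737488355328, 562949953421312), (4295006208, 262144, 140737488355328),
     (17180590080, 262144, 562949953421312), (268436064, 262144, 8796093022208)]⟩,
   ⟨35, 64176046119838592, (3, 4, 5, 7),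
    [(9009123400089600, 17592186044416, 281474976710656),
     (18029791672270848, 17592186044416, 562949953421312),
     (36275087623585792, 281474976710656, 562949953421312), (8589991936, 524288, 281474976710656),
     (17180327936, 524288, 562949953421312), (536871808, 524288, 17592186044416)]⟩,
   ⟨35, 71044912924066835, (0, 1, 6, 7),
    [(37726992728064, 34359738368, 1125899906842624),
     (75453985456128, 34359738368, 2251799813685248),
     (67553994410557440, 1125899906842624, 2251799813685248),
     (1151336448, 1048576, 1125899906842624), (2302672896, 1048576, 2251799813685248),
     (1043, 1048576, 34359738368)]⟩,
   ⟨35, 71120231769049125, (0, 2, 6, 7),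
    [(37692632989696, 68719476736, 1125899906842624),
     (150770531958784, 68719476736, 4503599627370496),
     (65302194596872192, 1125899906842624, 4503599627370496),
     (1150287872, 2097152, 1125899906842624), (4601151488, 2097152, 4503599627370496),
     (2085, 2097152, 68719476736)]⟩,
   ⟨35, 71157891191541833, (1, 2, 6, 7),
    [(75350906241024, 137438953472, 2251799813685248),
     (150701812482048, 137438953472, 4503599627370496),
     (64176294690029568, 2251799813685248, 4503599627370496),
     (2299527168, 4194304, 2251799813685248), (4599054336, 4194304, 4503599627370496),
     (4169, 4194304, 137438953472)]⟩,
   ⟨35, 71270182243278982, (0, 3, 6, 7),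
    [(37486474559488, 274877906944, 1125899906842624),
     (300716430196736, 274877906944, 9007199254740992),
     (60798594969501696, 1125899906842624, 9007199254740992),
     (1143996416, 8388608, 1125899906842624), (9177137152, 8388608, 9007199254740992),
     (8326, 8388608, 274877906944)]⟩,
   ⟨35, 71307635501056266, (1, 3, 6, 7),
    [(74938589380608, 549755813888, 2251799813685248),
     (300441552289792, 549755813888, 9007199254740992),
     (59672695062659072, 2251799813685248, 9007199254740992),
     (2286944256, 16777216, 2251799813685248), (9168748544, 16777216, 9007199254740992),
     (16650, 16777216, 549755813888)]⟩,
   ⟨35, 71382438934249996, (2, 3, 6, 7),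
    [(149739739807744, 1099511627776, 4503599627370496),
     (299891796475904, 1099511627776, 9007199254740992),
     (57420895248973824, 4503599627370496, 9007199254740992),
     (4569694208, 33554432, 4503599627370496), (9151971328, 33554432, 9007199254740992),
     (33292, 33554432, 1099511627776)]⟩,
   ⟨35, 71563211034394800, (0, 4, 6, 7),
    [(35562329210880, 2199023255552, 1125899906842624),
     (593736278999040, 2199023255552, 18014398509481984),
     (51791395714760704, 1125899906842624, 18014398509481984),
     (1085276160, 67108864, 1125899906842624), (18119393280, 67108864, 18014398509481984),
     (65712, 67108864, 2199023255552)]⟩,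
   ⟨35, 71598740088160592, (1, 4, 6, 7),
    [(71090298683392, 4398046511104, 2251799813685248),
     (591537255743488, 4398046511104, 18014398509481984),
     (50665495807918080, 2251799813685248, 18014398509481984),
     (2169503744, 134217728, 2251799813685248), (18052284416, 134217728, 18014398509481984),
     (131408, 134217728, 4398046511104)]⟩,
   ⟨35, 71669695113331296, (2, 4, 6, 7),
    [(142043158413312, 8796093022208, 4503599627370496),
     (587139209232384, 8796093022208, 18014398509481984),
     (48413695994232832, 4503599627370496, 18014398509481984),
     (4334813184, 268435456, 4503599627370496), (17918066688, 268435456, 18014398509481984),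
     (262752, 268435456, 8796093022208)]⟩,
   ⟨35, 71811055391081344, (3, 4, 6, 7),
    [(283399122059264, 17592186044416, 9007199254740992),
     (578343116210176, 17592186044416, 18014398509481984),
     (43910096366862336, 9007199254740992, 18014398509481984),
     (8648654848, 536870912, 9007199254740992), (17649631232, 536870912, 18014398509481984),
     (525184, 536870912, 17592186044416)]⟩,
   ⟨35, 72025020010933248, (0, 5, 6, 7),
    [(2576980377600, 35184372088832, 1125899906842624),
     (1055531162664960, 35184372088832, 36028797018963968),
     (33776997205278720, 1125899906842624, 36028797018963968),
     (78643200, 1073741824, 1125899906842624), (32212254720, 1073741824, 36028797018963968),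
     (76800, 1073741824, 35184372088832)]⟩,
   ⟨35, 72027562709242880, (1, 5, 6, 7),
    [(5119601016832, 70368744177664, 2251799813685248),
     (1020346790576128, 70368744177664, 36028797018963968),
     (32651097298436096, 2251799813685248, 36028797018963968),
     (156237824, 2147483648, 2251799813685248), (31138512896, 2147483648, 36028797018963968),
     (152576, 2147483648, 70368744177664)]⟩,
   ⟨35, 72032545023498240, (2, 5, 6, 7),
    [(10101763080192, 140737488355328, 4503599627370496),
     (949978046398464, 140737488355328, 36028797018963968),
     (30399297484750848, 4503599627370496, 36028797018963968),
     (308281344, 4294967296, 4503599627370496), (28991029248, 4294967296, 36028797018963968),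
     (301056, 4294967296, 140737488355328)]⟩,
   ⟨35, 72041959879401472, (3, 5, 6, 7),
    [(19516331393024, 281474976710656, 9007199254740992),
     (809240558043136, 281474976710656, 36028797018963968),
     (25895697857380352, 9007199254740992, 36028797018963968),
     (595591168, 8589934592, 9007199254740992), (24696061952, 8589934592, 36028797018963968),
     (581632, 8589934592, 281474976710656)]⟩,
   ⟨35, 72055429308284928, (4, 5, 6, 7),
    [(32985348833280, 562949953421312, 18014398509481984),
     (527765581332480, 562949953421312, 36028797018963968),
     (16888498602639360, 18014398509481984, 36028797018963968),
     (1006632960, 17179869184, 18014398509481984), (16106127360, 17179869184, 36028797018963968),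
     (983040, 17179869184, 562949953421312)]⟩]

/-- The action of the transpositions of consecutive vertices of `{0, …, 5}` on the triples. -/
def transpositionTable : List (List (ℕ × ℕ)) :=
  [[(0, 0), (1, 1), (2, 3), (3, 2), (4, 4), (5, 6), (6, 5), (7, 8), (8, 7), (9, 9), (10, 10), (11,
    12), (12, 11), (13, 14), (14, 13), (15, 15), (16, 17), (17, 16), (18, 18), (19, 19)],
   [(0, 0), (1, 2), (2, 1), (3, 3), (4, 5), (5, 4), (6, 6), (7, 7), (8, 9), (9, 8), (10, 11), (11,
    10), (12, 12), (13, 13), (14, 15), (15, 14), (16, 16), (17, 18), (18, 17), (19, 19)],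
   [(0, 1), (1, 0), (2, 2), (3, 3), (4, 4), (5, 7), (6, 8), (7, 5), (8, 6), (9, 9), (10, 10), (11,
    13), (12, 14), (13, 11), (14, 12), (15, 15), (16, 16), (17, 17), (18, 19), (19, 18)],
   [(0, 0), (1, 4), (2, 5), (3, 6), (4, 1), (5, 2), (6, 3), (7, 7), (8, 8), (9, 9), (10, 10), (11,
    11), (12, 12), (13, 16), (14, 17), (15, 18), (16, 13), (17, 14), (18, 15), (19, 19)],
   [(0, 0), (1, 1), (2, 2), (3, 3), (4, 10), (5, 11), (6, 12), (7, 13), (8, 14), (9, 15), (10, 4),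
    (11, 5), (12, 6), (13, 7), (14, 8), (15, 9), (16, 16), (17, 17), (18, 18), (19, 19)]]

theorem exists_testBit_of_land_ne_zero {a m : ℕ} (h : Nat.beq (Nat.land a m) 0 = false) :
    ∃ x, a.testBit x ∧ m.testBit x := by
  have h0 : a &&& m ≠ 0 := by
    intro h0
    have h1 : Nat.beq (a &&& m) 0 = true := by rw [h0]; rfl
    exact Bool.false_ne_true (h.symm.trans h1)
  obtain ⟨x, hx⟩ := Nat.exists_testBit_of_ne_zero h0
  rw [Nat.testBit_and, Bool.and_eq_true] at hx
  exact ⟨x, hx⟩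

theorem beq_land_two_pow (a x : ℕ) : Nat.beq (Nat.land a (Nat.pow 2 x)) 0 = !a.testBit x := by
  have h : a &&& 2 ^ x = (a.testBit x).toNat * 2 ^ x := Nat.and_two_pow a x
  change Nat.beq (a &&& 2 ^ x) 0 = _
  rw [h]
  cases a.testBit x
  · rw [Bool.toNat_false, zero_mul]; rfl
  · rw [Bool.toNat_true, one_mul, Bool.not_true, ← Bool.not_eq_true]
    exact fun h => (Nat.two_pow_pos x).ne' (Nat.eq_of_beq_eq_true h)

/-- Conditions on rows under which `hasReps` is sound. -/
def GoodRows (l : List (ℕ × ℕ × ℕ)) : Prop :=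
  l.Pairwise (fun r s => r.1 &&& (s.1 ||| s.2.1 ||| s.2.2) = 0) ∧
    ∀ r ∈ l, r.2.1 = 2 ^ r.2.1.log2 ∧ r.2.2 = 2 ^ r.2.2.log2

instance (l : List (ℕ × ℕ × ℕ)) : Decidable (GoodRows l) := by
  unfold GoodRows; infer_instance

theorem exists_reps_of_hasReps {l : List (ℕ × ℕ × ℕ)} (hl : GoodRows l) {a : ℕ}
    (h : hasReps l a = true) :
    ∃ xs : List ℕ, xs.Nodup ∧ (∀ x ∈ xs, a.testBit x) ∧
      List.Forall₂ (fun r x => (r.1 ||| r.2.1 ||| r.2.2).testBit x) l xs := by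
  induction l generalizing a with
  | nil => exact ⟨[], by simp⟩
  | cons r l ih =>
    obtain ⟨h1, h2⟩ := hl
    rw [List.pairwise_cons] at h1
    have hl : GoodRows l := ⟨h1.2, fun s hs => h2 s (List.mem_cons_of_mem _ hs)⟩
    have key : ∀ m, m = 2 ^ m.log2 → (m = r.2.1 ∨ m = r.2.2) →
        (bif Nat.beq (Nat.land a m) 0 then false else hasReps l (Nat.xor a m)) = true →
        ∃ xs : List ℕ, xs.Nodup ∧ (∀ x ∈ xs, a.testBit x) ∧
          List.Forall₂ (fun r x => (r.1 ||| r.2.1 ||| r.2.2).testBit x) (r :: l) xs := by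
      intro m hx hm h
      obtain ⟨x, rfl⟩ : ∃ x, m = 2 ^ x := ⟨_, hx⟩
      clear hx
      change (bif Nat.beq (Nat.land a (Nat.pow 2 x)) 0 then false else _) = true at h
      rw [beq_land_two_pow] at h
      cases hx : a.testBit x with
      | false => simp [hx] at h
      | true =>
        simp only [hx, Bool.not_true, cond_false] at h
        obtain ⟨xs, hn, ha, hf⟩ := ih hl h
        have ha' : ∀ y ∈ xs, y ≠ x ∧ a.testBit y := by
          intro y hy
          have := ha y hy
          change (a ^^^ 2 ^ x).testBit y = true at this
          rw [Nat.testBit_xor, Nat.testBit_two_pow] at this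
          by_cases hxy : x = y
          · subst hxy; simp [hx] at this
          · simpa [hxy, Ne.symm hxy] using this
        refine ⟨x :: xs, List.nodup_cons.2 ⟨fun hxs => (ha' x hxs).1 rfl, hn⟩, ?_, ?_⟩
        · intro y hy
          rcases List.mem_cons.1 hy with rfl | hy
          · exact hx
          · exact (ha' y hy).2
        · refine List.Forall₂.cons ?_ hf
          rcases hm with hm | hm <;> rw [← hm] <;> simp [Nat.testBit_or]
    have h' : (bif Nat.beq (Nat.land a r.1) 0 then
      (bif Nat.beq (Nat.land a r.2.1) 0 then false else hasReps l (Nat.xor a r.2.1)) ||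
      (bif Nat.beq (Nat.land a r.2.2) 0 then false else hasReps l (Nat.xor a r.2.2))
      else hasReps l a) = true := h
    cases h0 : Nat.beq (Nat.land a r.1) 0 with
    | true =>
      rw [h0, cond_true, Bool.or_eq_true] at h'
      rcases h' with h' | h'
      · exact key _ (h2 r List.mem_cons_self).1 (Or.inl rfl) h'
      · exact key _ (h2 r List.mem_cons_self).2 (Or.inr rfl) h'
    | false =>
      rw [h0, cond_false] at h'
      obtain ⟨x, hxa, hxr⟩ := exists_testBit_of_land_ne_zero h0
      obtain ⟨xs, hn, ha, hf⟩ := ih hl h'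
      refine ⟨x :: xs, List.nodup_cons.2 ⟨fun hxs => ?_, hn⟩, ?_, ?_⟩
      · obtain ⟨s, hs, hsx⟩ : ∃ s ∈ l, (s.1 ||| s.2.1 ||| s.2.2).testBit x := by
          obtain ⟨i, hi, rfl⟩ := List.mem_iff_getElem.1 hxs
          have hi' : i < l.length := by rw [hf.length_eq]; exact hi
          exact ⟨l[i], List.getElem_mem _, hf.get hi' hi⟩
        have := congrArg (Nat.testBit · x) (h1.1 s hs)
        simp only [Nat.testBit_and, hxr, hsx, Nat.zero_testBit] at this
        simp at this
      · intro y hy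
        rcases List.mem_cons.1 hy with rfl | hy
        · exact hxa
        · exact ha y hy
      · exact List.Forall₂.cons (by simp [Nat.testBit_or, hxr]) hf

/-- The mask with the first `d` bits of `h`. -/
def maskOf (h : ℕ → Bool) : ℕ → ℕ
  | 0 => 0
  | d + 1 => if h d then maskOf h d ||| 2 ^ d else maskOf h d

theorem testBit_maskOf (h : ℕ → Bool) (d x : ℕ) :
    (maskOf h d).testBit x = (decide (x < d) && h x) := by
  induction d with
  | zero => simp [maskOf]
  | succ d ih =>
    have h1 : decide (x < d + 1) = (decide (x < d) || decide (d = x)) := by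
      rw [← Bool.decide_or]; congr 1; apply propext; omega
    rw [maskOf]
    split_ifs with hd
    · rw [Nat.testBit_or, ih, Nat.testBit_two_pow, h1]
      by_cases hx : d = x
      · subst hx; simp [hd]
      · simp [hx]
    · rw [ih, h1]
      by_cases hx : d = x
      · subst hx; simp [hd]
      · simp [hx]

/-- The number with binary digits `h x`, for `x ∈ l`. -/
def binaryValue (h : ℕ → Bool) : List ℕ → ℕ
  | [] => 0
  | x :: l => (h x).toNat * 2 ^ l.length + binaryValue h l

theorem binaryValue_lt (h : ℕ → Bool) (l : List ℕ) : binaryValue h l < 2 ^ l.length := by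
  induction l with
  | nil => simp [binaryValue]
  | cons x l ih =>
    rw [binaryValue, List.length_cons, pow_succ]
    cases h x <;> simp <;> omega

theorem binaryValue_lt_of_lexSmaller {h : ℕ → Bool} {d : ℕ} {l : List (ℕ × ℕ)}
    (hl : lexSmaller d (maskOf h d) l = true) :
    binaryValue h (l.map Prod.fst) < binaryValue h (l.map Prod.snd) := by
  induction l with
  | nil => cases hl
  | cons r l ih =>
    change (bif Nat.ble d r.1 then false else bif Nat.ble d r.2 then false
      else bif Nat.beq (Nat.land (maskOf h d) (Nat.pow 2 r.1)) 0 then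
        bif Nat.beq (Nat.land (maskOf h d) (Nat.pow 2 r.2)) 0 then lexSmaller d (maskOf h d) l
        else true
      else bif Nat.beq (Nat.land (maskOf h d) (Nat.pow 2 r.2)) 0 then false
        else lexSmaller d (maskOf h d) l) = true at hl
    simp only [beq_land_two_pow, testBit_maskOf] at hl
    cases h1 : Nat.ble d r.1 with
    | true => simp [h1] at hl
    | false =>
    cases h2 : Nat.ble d r.2 with
    | true => simp [h1, h2] at hl
    | false =>
    have h1' : r.1 < d := by
      by_contra hc
      rw [Nat.ble_eq_true_of_le (not_lt.1 hc)] at h1; cases h1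
    have h2' : r.2 < d := by
      by_contra hc
      rw [Nat.ble_eq_true_of_le (not_lt.1 hc)] at h2; cases h2
    simp only [h1, h2, h1', h2', cond_false, decide_true, Bool.true_and] at hl
    have hv := binaryValue_lt h (l.map Prod.fst)
    simp only [List.map_cons, binaryValue, List.length_map] at hv ⊢
    cases e1 : h r.1 <;> cases e2 : h r.2 <;> simp only [e1, e2] at hl
    · simpa using ih hl
    · simp; omega
    · simp at hl
    · simpa using ih hl

theorem exists_count_lt_of_tooFew {h : ℕ → Bool} {d : ℕ} {l : List (ℕ × ℕ)}
    (hl : tooFew d (Nat.count (h ·) d) l = true) :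
    ∃ r ∈ l, Nat.count (h ·) r.1 < r.2 := by
  induction l with
  | nil => cases hl
  | cons r l ih =>
    rw [tooFew, Bool.or_eq_true, Bool.and_eq_true] at hl
    rcases hl with ⟨h1, h2⟩ | hl
    · refine ⟨r, List.mem_cons_self, ?_⟩
      have h1 : d ≤ r.1 := Nat.le_of_ble_eq_true h1
      have h2 : Nat.count (h ·) d + (r.1 - d) < r.2 := Nat.le_of_ble_eq_true h2
      obtain ⟨e, he⟩ := Nat.exists_eq_add_of_le h1
      have := Nat.count_add (h ·) d e
      have := Nat.count_le (p := fun k => (h (d + k) : Prop)) (n := e)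
      rw [he] at h2 ⊢
      omega
    · obtain ⟨r, hr, h⟩ := ih hl
      exact ⟨r, List.mem_cons_of_mem _ hr, h⟩

theorem exists_quad_of_mem_touching {d : ℕ} {l : List Quad} {rows : List (ℕ × ℕ × ℕ)}
    (h : rows ∈ touching d l) : ∃ K ∈ l, K.pairs = rows := by
  induction l with
  | nil => cases h
  | cons K l ih =>
    rw [touching] at h
    cases h1 : Nat.ble K.start d <;>
      cases h2 : Nat.beq (Nat.land (Nat.pow 2 d) K.touch) 0 <;>
      simp only [h1, h2, cond_true, cond_false, List.mem_cons, List.not_mem_nil] at h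
    · rcases h with rfl | h
      · exact ⟨K, by simp⟩
      · obtain ⟨K', h, h'⟩ := ih h
        exact ⟨K', by simp [h], h'⟩
    · obtain ⟨K', h, h'⟩ := ih h
      exact ⟨K', by simp [h], h'⟩

theorem exists_obstruction_of_refuted {qt : List Quad} {tt : List (List (ℕ × ℕ))}
    {req : List (ℕ × ℕ)} {N k : ℕ} (hk : k ≤ N) {h : ℕ → Bool}
    (hr : refuted qt tt req N k (Nat.count (h ·) (N - k)) (maskOf h (N - k)) = true) :
    (∃ r ∈ req, Nat.count (h ·) r.1 < r.2) ∨
    (∃ l ∈ tt, binaryValue h (l.map Prod.fst) < binaryValue h (l.map Prod.snd)) ∨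
    ∃ K ∈ qt, ∃ d, hasReps K.pairs (maskOf h d) = true := by
  induction k with
  | zero => exact Or.inl (exists_count_lt_of_tooFew hr)
  | succ k ih =>
    obtain ⟨d, hd⟩ : ∃ d, N - (k + 1) = d := ⟨_, rfl⟩
    have hd' : N - k = d + 1 := by omega
    have hr' : (tooFew (N - (k + 1)) (Nat.count (h ·) (N - (k + 1))) req ||
      (Nat.ble (N - (k + 1)) 20 && tt.any (lexSmaller (N - (k + 1)) (maskOf h (N - (k + 1))))) ||
      ((touching (N - (k + 1)) qt).any
          (hasReps · (maskOf h (N - (k + 1)) ||| 2 ^ (N - (k + 1)))) ||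
        refuted qt tt req N k (Nat.count (h ·) (N - (k + 1)) + 1)
          (maskOf h (N - (k + 1)) ||| 2 ^ (N - (k + 1)))) &&
      refuted qt tt req N k (Nat.count (h ·) (N - (k + 1))) (maskOf h (N - (k + 1)))) = true := hr
    rw [hd] at hr'
    rw [hd', Nat.count_succ, maskOf] at ih
    rw [Bool.or_eq_true, Bool.or_eq_true, Bool.and_eq_true, Bool.and_eq_true, Bool.or_eq_true]
      at hr'
    rcases hr' with (hr' | ⟨-, hr'⟩) | ⟨h1, h2⟩
    · exact Or.inl (exists_count_lt_of_tooFew hr')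
    · obtain ⟨l, hl, h⟩ := List.any_eq_true.1 hr'
      exact Or.inr (Or.inl ⟨l, hl, binaryValue_lt_of_lexSmaller h⟩)
    · by_cases hh : h d = true
      · simp only [hh, if_true] at ih
        rcases h1 with h1 | h1
        · obtain ⟨rows, hrows, h3⟩ := List.any_eq_true.1 h1
          obtain ⟨K, hK, rfl⟩ := exists_quad_of_mem_touching hrows
          refine Or.inr (Or.inr ⟨K, hK, d + 1, ?_⟩)
          rw [maskOf, if_pos hh]
          exact h3
        · exact ih (by omega) h1
      · simp only [hh] at ih
        exact ih (by omega) (by simpa using h2)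

/-- The triples in `{0, …, 7}`, in colexicographic order. -/
def tripleList : List (Finset (Fin 8)) :=
  (List.finRange 8).flatMap fun k => (List.finRange 8).flatMap fun j =>
    (List.finRange 8).flatMap fun i => if i < j ∧ j < k then [{i, j, k}] else []

/-- The `x`-th triple in `{0, …, 7}`, in colexicographic order. -/
def triple (x : ℕ) : Finset (Fin 8) := tripleList.getD x ∅

theorem length_tripleList : tripleList.length = 56 := by decide +kernel

theorem tripleList_nodup : tripleList.Nodup := by decide +kernel

theorem triple_of_le {x : ℕ} (h : 56 ≤ x) : triple x = ∅ :=
  List.getD_eq_default _ _ (by rwa [length_tripleList])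

theorem triple_injOn {x y : ℕ} (hx : x < 56) (hy : y < 56) (h : triple x = triple y) : x = y := by
  rw [← length_tripleList] at hx hy
  rw [triple, triple, List.getD_eq_getElem _ _ hx, List.getD_eq_getElem _ _ hy] at h
  exact tripleList_nodup.getElem_inj_iff.1 h

theorem tripleList_toFinset : tripleList.toFinset = Finset.powersetCard 3 Finset.univ := by
  refine Finset.eq_of_subset_of_card_le (fun t ht => ?_) ?_
  · simp only [List.mem_toFinset, tripleList, List.mem_flatMap] at ht
    obtain ⟨k, -, j, -, i, -, h⟩ := ht
    split_ifs at h with hij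
    · rw [List.mem_singleton] at h
      rw [Finset.mem_powersetCard_univ, h, Finset.card_eq_three]
      exact ⟨i, j, k, by omega, by omega, by omega, rfl⟩
    · simp at h
  · rw [List.toFinset_card_of_nodup tripleList_nodup, length_tripleList, Finset.card_powersetCard]
    decide

theorem exists_triple_eq {m : ℕ} (h6 : 6 ≤ m) (h8 : m ≤ 8) {s : Finset (Fin 8)} (hs : s.card = 3)
    (hm : ∀ i ∈ s, i.val < m) : ∃ x < m.choose 3, triple x = s := by
  have h20 : ∀ x < 56, 20 ≤ x → 6 ∈ triple x ∨ 7 ∈ triple x := by decide +kernel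
  have h35 : ∀ x < 56, 35 ≤ x → 7 ∈ triple x := by decide +kernel
  obtain ⟨x, hx, hxs⟩ := List.mem_iff_getElem.1 (List.mem_toFinset.1
    (tripleList_toFinset ▸ Finset.mem_powersetCard.2 ⟨Finset.subset_univ s, hs⟩))
  have hxs' : triple x = s := by rw [triple, List.getD_eq_getElem _ _ hx, hxs]
  rw [length_tripleList] at hx
  refine ⟨x, ?_, hxs'⟩
  by_contra hc
  rw [not_lt] at hc
  replace h20 := h20 x hx
  replace h35 := h35 x hx
  rw [hxs'] at h20 h35
  interval_cases m
  · rcases h20 hc with h | h <;> exact absurd (hm _ h) (by decide)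
  · exact absurd (hm _ (h35 hc)) (by decide)
  · exact absurd hx (not_lt.2 hc)

/-- The pairs of vertices in the order used by `Quad.pairs`. -/
def Quad.edges (K : Quad) : List (Fin 8 × Fin 8) :=
  let (i, j, k, l) := K.vertices
  [(i, l), (j, l), (k, l), (i, k), (j, k), (i, j)]

/-- The mask of the triples containing `u` and `v`. -/
def pairMask (u v : Fin 8) : ℕ :=
  maskOf (fun x => decide (u ∈ triple x ∧ v ∈ triple x)) 56

theorem subset_of_testBit_pairMask {u v : Fin 8} {x : ℕ} (h : (pairMask u v).testBit x) :
    {u, v} ⊆ triple x := by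
  rw [pairMask, testBit_maskOf, Bool.and_eq_true, decide_eq_true_iff, decide_eq_true_iff] at h
  simpa [Finset.insert_subset_iff] using h.2

theorem quadTable_valid {K : Quad} (hK : K ∈ quadTable) :
    [K.vertices.1, K.vertices.2.1, K.vertices.2.2.1, K.vertices.2.2.2].Nodup ∧ GoodRows K.pairs ∧
    K.pairs.map (fun r => r.1 ||| r.2.1 ||| r.2.2) = K.edges.map fun e => pairMask e.1 e.2 := by
  have key : ∀ K ∈ quadTable,
    [K.vertices.1, K.vertices.2.1, K.vertices.2.2.1, K.vertices.2.2.2].Nodup ∧ GoodRows K.pairs ∧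
    K.pairs.map (fun r => r.1 ||| r.2.1 ||| r.2.2) = K.edges.map fun e => pairMask e.1 e.2 := by
    decide +kernel
  exact key K hK

theorem transpositionTable_valid {l : List (ℕ × ℕ)} (hl : l ∈ transpositionTable) :
    l.map Prod.fst = List.range 20 ∧ ∃ a < (6 : Fin 8), ∃ b < (6 : Fin 8),
      ∀ r ∈ l, triple r.2 = (triple r.1).image (Equiv.swap a b) := by
  have key : ∀ l ∈ transpositionTable, l.map Prod.fst = List.range 20 ∧ ∃ a < (6 : Fin 8),
    ∃ b < (6 : Fin 8), ∀ r ∈ l, triple r.2 = (triple r.1).image (Equiv.swap a b) := by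
    decide +kernel
  exact key l hl

theorem binaryValue_map_congr {α : Type*} {g h : ℕ → Bool} {p q : α → ℕ} {l : List α}
    (H : ∀ r ∈ l, g (p r) = h (q r)) : binaryValue g (l.map p) = binaryValue h (l.map q) := by
  induction l with
  | nil => rfl
  | cons r l ih =>
    simp only [List.map_cons, binaryValue, List.length_map, H r List.mem_cons_self,
      ih fun r hr => H r (List.mem_cons_of_mem _ hr)]

theorem hasBergeK4_of_hasReps {H : Finset (Finset (Fin 8))} (h3 : ∀ t ∈ H, t.card = 3)
    (σ : Equiv.Perm (Fin 8)) {h : ℕ → Bool} (hh : ∀ x, h x = true ↔ (triple x).image σ ∈ H)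
    {K : Quad} (hK : K ∈ quadTable) {d : ℕ} (hr : hasReps K.pairs (maskOf h d) = true) :
    HasBergeK4 H := by
  obtain ⟨hv, hg, hz⟩ := quadTable_valid hK
  obtain ⟨xs, hn, hx, hf⟩ := exists_reps_of_hasReps hg hr
  have hx' : ∀ x ∈ xs, x < 56 ∧ (triple x).image σ ∈ H := by
    intro x hxs
    have h1 := hx x hxs
    rw [testBit_maskOf, Bool.and_eq_true, hh] at h1
    refine ⟨?_, h1.2⟩
    by_contra hc
    have := h3 _ h1.2
    simp [triple_of_le (not_lt.1 hc)] at this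
  obtain ⟨start, touch, ⟨i, j, k, l⟩, pairs⟩ := K
  have hf' : List.Forall₂ (fun (r : ℕ) x => r.testBit x)
      (pairs.map fun r => r.1 ||| r.2.1 ||| r.2.2) xs := List.forall₂_map_left_iff.2 hf
  rw [show pairs.map (fun r => r.1 ||| r.2.1 ||| r.2.2) = _ from hz] at hf'
  simp only [Quad.edges, List.map_cons, List.map_nil] at hf' hv
  match xs, hf' with
  | [x1, x2, x3, x4, x5, x6], hf =>
  simp only [List.forall₂_cons, List.Forall₂.nil, and_true] at hf
  obtain ⟨f1, f2, f3, f4, f5, f6⟩ := hf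
  have hne : ∀ x ∈ [x1, x2, x3, x4, x5, x6], ∀ y ∈ [x1, x2, x3, x4, x5, x6],
      (triple x).image σ = (triple y).image σ → x = y := fun x hx y hy hxy =>
    triple_injOn (hx' x hx).1 (hx' y hy).1 (Finset.image_injective σ.injective hxy)
  have hnd := List.Nodup.map_on (f := fun x => (triple x).image σ) hne hn
  simp only [List.mem_cons, List.not_mem_nil, or_false, forall_eq_or_imp, forall_eq] at hx'
  obtain ⟨⟨-, m1⟩, ⟨-, m2⟩, ⟨-, m3⟩, ⟨-, m4⟩, ⟨-, m5⟩, ⟨-, m6⟩⟩ := hx'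
  have hs : ∀ {u v : Fin 8} {x : ℕ}, (pairMask u v).testBit x →
      {σ u, σ v} ⊆ (triple x).image σ := by
    intro u v x h
    simpa [Finset.image_insert] using
      Finset.image_subset_image (f := σ) (subset_of_testBit_pairMask h)
  simp only [List.nodup_cons, List.mem_cons, List.not_mem_nil, or_false, not_or] at hv
  refine ⟨σ i, σ j, σ k, σ l, (triple x6).image σ, (triple x4).image σ, (triple x1).image σ,
    (triple x5).image σ, (triple x2).image σ, (triple x3).image σ, ?_, ?_, ?_, ?_, ?_, ?_, ?_,
    m6, m4, m1, m5, m2, m3, hs f6, hs f4, hs f1, hs f5, hs f2, hs f3⟩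
  iterate 6 exact σ.injective.ne (by tauto)
  simp only [List.map_cons, List.map_nil, List.nodup_cons, List.mem_cons,
    List.not_mem_nil, or_false, not_or] at hnd ⊢
  grind

theorem exists_card_lt_of_refuted {H : Finset (Finset (Fin 8))} (h3 : ∀ t ∈ H, t.card = 3)
    (hH : ¬ HasBergeK4 H) {req : List (ℕ × ℕ)} {N : ℕ}
    (hr : refuted quadTable transpositionTable req N N 0 0 = true)
    (hreq : ∀ r ∈ req, ∃ m, 6 ≤ m ∧ m ≤ 8 ∧ r.1 = m.choose 3 ∧
      r.2 ≤ (H.filter fun t => ∀ i ∈ t, i.val < m).card) : False := by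
  let h : Equiv.Perm (Fin 8) → ℕ → Bool := fun σ x => decide ((triple x).image σ ∈ H)
  obtain ⟨σ, hσ, hmax⟩ := Finset.exists_max_image
    (Finset.univ.filter fun σ : Equiv.Perm (Fin 8) => σ 6 = 6 ∧ σ 7 = 7)
    (fun σ => binaryValue (h σ) (List.range 20)) ⟨1, by simp⟩
  simp only [Finset.mem_filter, Finset.mem_univ, true_and] at hσ hmax
  have hr' : refuted quadTable transpositionTable req N N (Nat.count (h σ ·) (N - N))
      (maskOf (h σ) (N - N)) = true := by
    simpa [maskOf] using hr
  rcases exists_obstruction_of_refuted le_rfl hr' with ⟨r, hr, hlt⟩ | ⟨l, hl, hlt⟩ | ⟨K, hK, d, hK'⟩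
  · obtain ⟨m, h6, h8, hm, hle⟩ := hreq r hr
    refine absurd (hle.trans ?_) (not_le.2 hlt)
    rw [Nat.count_eq_card_filter_range, hm]
    refine le_trans (Finset.card_le_card (t := ((Finset.range (m.choose 3)).filter
      (h σ ·)).image fun x => (triple x).image σ) ?_) Finset.card_image_le
    intro t ht
    rw [Finset.mem_filter] at ht
    have hσm : ∀ i : Fin 8, i.val < m → (σ.symm i).val < m := by
      intro i hi
      by_contra hc
      have h67 : σ.symm i = 6 ∨ σ.symm i = 7 := by omega
      rcases h67 with h | h
      · have : i = 6 := by rw [← hσ.1, ← h, Equiv.apply_symm_apply]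
        subst this
        rw [h] at hc; exact hc hi
      · have : i = 7 := by rw [← hσ.2, ← h, Equiv.apply_symm_apply]
        subst this
        rw [h] at hc; exact hc hi
    obtain ⟨x, hx, hxt⟩ := exists_triple_eq h6 h8 (s := t.image σ.symm)
      (by rw [Finset.card_image_of_injective _ σ.symm.injective, h3 t ht.1])
      (by
        intro i hi
        obtain ⟨j, hj, rfl⟩ := Finset.mem_image.1 hi
        exact hσm j (ht.2 j hj))
    have hxt' : (triple x).image σ = t := by
      rw [hxt, Finset.image_image, Equiv.self_comp_symm, Finset.image_id]
    exact Finset.mem_image.2 ⟨x, by simp [h, hx, hxt', ht.1], hxt'⟩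
  · obtain ⟨hl1, a, ha, b, hb, hab⟩ := transpositionTable_valid hl
    refine absurd (hmax (σ * Equiv.swap a b) ?_) (not_le.2 ?_)
    · rw [Equiv.Perm.mul_apply, Equiv.Perm.mul_apply,
        Equiv.swap_apply_of_ne_of_ne (by omega) (by omega),
        Equiv.swap_apply_of_ne_of_ne (by omega) (by omega)]
      exact hσ
    · rw [← hl1]
      refine lt_of_lt_of_eq hlt (binaryValue_map_congr ?_).symm
      intro r hr
      simp only [h, hab r hr, Finset.image_image, Equiv.Perm.coe_mul]
      exact decide_eq_decide.2 Iff.rfl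
  · exact hH (hasBergeK4_of_hasReps h3 σ (by simp [h]) hK hK')

theorem refuted_six : refuted quadTable transpositionTable [(20, 9)] 20 20 0 0 = true := by
  decide +kernel

theorem refuted_seven :
    refuted quadTable transpositionTable [(20, 8), (35, 13)] 35 35 0 0 = true := by
  decide +kernel

theorem refuted_eight :
    refuted quadTable transpositionTable [(20, 7), (35, 12), (56, 19)] 56 56 0 0 = true := by
  decide +kernel

section

variable {V W : Type*} [DecidableEq V] [DecidableEq W]

theorem HasBergeK4.mono {H G : Finset (Finset V)} (hHG : H ⊆ G) (h : HasBergeK4 H) :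
    HasBergeK4 G := by
  obtain ⟨v₁, v₂, v₃, v₄, e₁₂, e₁₃, e₁₄, e₂₃, e₂₄, e₃₄, n1, n2, n3, n4, n5, n6, hn, m1, m2, m3, m4,
    m5, m6, hs⟩ := h
  exact ⟨v₁, v₂, v₃, v₄, e₁₂, e₁₃, e₁₄, e₂₃, e₂₄, e₃₄, n1, n2, n3, n4, n5, n6, hn, hHG m1, hHG m2,
    hHG m3, hHG m4, hHG m5, hHG m6, hs⟩

theorem HasBergeK4.of_image {f : V → W} (hf : f.Injective) {H : Finset (Finset V)}
    (h : HasBergeK4 (H.image (Finset.image f))) : HasBergeK4 H := by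
  obtain ⟨v₁, v₂, v₃, v₄, e₁₂, e₁₃, e₁₄, e₂₃, e₂₄, e₃₄, n1, n2, n3, n4, n5, n6, hn, m1, m2, m3, m4,
    m5, m6, s1, s2, s3, s4, s5, s6⟩ := h
  obtain ⟨e₁₂, k1, rfl⟩ := Finset.mem_image.1 m1
  obtain ⟨e₁₃, k2, rfl⟩ := Finset.mem_image.1 m2
  obtain ⟨e₁₄, k3, rfl⟩ := Finset.mem_image.1 m3
  obtain ⟨e₂₃, k4, rfl⟩ := Finset.mem_image.1 m4
  obtain ⟨e₂₄, k5, rfl⟩ := Finset.mem_image.1 m5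
  obtain ⟨e₃₄, k6, rfl⟩ := Finset.mem_image.1 m6
  obtain ⟨v₁, -, rfl⟩ := Finset.mem_image.1 (s1 (Finset.mem_insert_self _ _))
  obtain ⟨v₂, -, rfl⟩ := Finset.mem_image.1 (s4 (Finset.mem_insert_self _ _))
  obtain ⟨v₃, -, rfl⟩ := Finset.mem_image.1 (s6 (Finset.mem_insert_self _ _))
  obtain ⟨v₄, -, rfl⟩ := Finset.mem_image.1
    (s6 (Finset.mem_insert_of_mem (Finset.mem_singleton_self _)))
  have hs : ∀ {u v : V} {e : Finset V}, {f u, f v} ⊆ e.image f → {u, v} ⊆ e := by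
    intro u v e h
    rw [← Finset.image_singleton, ← Finset.image_insert] at h
    exact (Finset.image_subset_image_iff hf).1 h
  refine ⟨v₁, v₂, v₃, v₄, e₁₂, e₁₃, e₁₄, e₂₃, e₂₄, e₃₄, ne_of_apply_ne f n1, ne_of_apply_ne f n2,
    ne_of_apply_ne f n3, ne_of_apply_ne f n4, ne_of_apply_ne f n5, ne_of_apply_ne f n6,
    List.Nodup.of_map (Finset.image f) hn, k1, k2, k3, k4, k5, k6, hs s1, hs s2, hs s3, hs s4,
    hs s5, hs s6⟩

theorem sum_card_filter_mem {S : Finset V} {H : Finset (Finset V)} (hS : ∀ t ∈ H, t ⊆ S) :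
    ∑ x ∈ S, (H.filter (x ∈ ·)).card = ∑ t ∈ H, t.card := by
  rw [Finset.sum_congr rfl fun t ht => congrArg Finset.card (show t = S.filter (· ∈ t) from by
    rw [Finset.filter_mem_eq_inter, Finset.inter_eq_right.2 (hS t ht)])]
  exact Finset.sum_card_bipartiteAbove_eq_sum_card_bipartiteBelow (· ∈ ·)

theorem exists_card_mul_degree_le {S : Finset V} (hne : S.Nonempty) {H : Finset (Finset V)} {k : ℕ}
    (hS : ∀ t ∈ H, t ⊆ S) (hk : ∀ t ∈ H, t.card = k) :
    ∃ x ∈ S, S.card * (H.filter (x ∈ ·)).card ≤ H.card * k := by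
  obtain ⟨x, hx, hmin⟩ := S.exists_min_image (fun x => (H.filter (x ∈ ·)).card) hne
  refine ⟨x, hx, ?_⟩
  rw [← Finset.sum_const_nat hk, ← sum_card_filter_mem hS, ← smul_eq_mul]
  exact Finset.card_nsmul_le_sum _ _ _ hmin

theorem card_filter_not_mem_add (H : Finset (Finset V)) (x : V) :
    (H.filter (x ∉ ·)).card + (H.filter (x ∈ ·)).card = H.card := by
  rw [add_comm]; exact Finset.card_filter_add_card_filter_not _

end

/-- The triple system `H` on `{0, …, 7}`, restricted by deleting `v` and then `u`, does not have the
sizes excluded by an exhaustive search. -/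
theorem false_of_refuted {H : Finset (Finset (Fin 8))} (h3 : ∀ t ∈ H, t.card = 3)
    (hH : ¬ HasBergeK4 H) {u v : Fin 8} (huv : u ≠ v) {req : List (ℕ × ℕ)} {N : ℕ}
    (hr : refuted quadTable transpositionTable req N N 0 0 = true)
    (hreq : ∀ r ∈ req, r.1 = 20 ∧ r.2 ≤ ((H.filter (v ∉ ·)).filter (u ∉ ·)).card ∨
      r.1 = 35 ∧ r.2 ≤ (H.filter (v ∉ ·)).card ∨ r.1 = 56 ∧ r.2 ≤ H.card) : False := by
  let σ : Equiv.Perm (Fin 8) := (Equiv.swap v 7).trans (Equiv.swap (Equiv.swap v 7 u) 6)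
  have hσu : σ u = 6 := by simp [σ]
  have hσv : σ v = 7 := by
    have h1 : Equiv.swap v 7 u ≠ 7 := by
      intro h
      exact huv ((Equiv.swap v 7).injective (h.trans (Equiv.swap_apply_left v 7).symm))
    simp only [σ, Equiv.trans_apply, Equiv.swap_apply_left]
    exact Equiv.swap_apply_of_ne_of_ne h1.symm (by decide)
  have hinj := Finset.image_injective σ.injective
  have hle : ∀ (m : ℕ) (G : Finset (Finset (Fin 8))), G ⊆ H →
      (∀ t ∈ G, ∀ i ∈ t, (σ i).val < m) →
      G.card ≤ ((H.image (Finset.image σ)).filter fun t => ∀ i ∈ t, i.val < m).card := by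
    intro m G hG hm
    rw [← Finset.card_image_of_injective G hinj]
    refine Finset.card_le_card fun t ht => ?_
    obtain ⟨t, ht', rfl⟩ := Finset.mem_image.1 ht
    refine Finset.mem_filter.2 ⟨Finset.mem_image_of_mem _ (hG ht'), fun i hi => ?_⟩
    obtain ⟨i, hi', rfl⟩ := Finset.mem_image.1 hi
    exact hm t ht' i hi'
  have h7 : ∀ i, i ≠ v → (σ i).val < 7 := by
    intro i hi
    have : σ i ≠ 7 := hσv ▸ σ.injective.ne hi
    omega
  have h6 : ∀ i, i ≠ v → i ≠ u → (σ i).val < 6 := by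
    intro i hv hu
    have := h7 i hv
    have : σ i ≠ 6 := hσu ▸ σ.injective.ne hu
    omega
  refine exists_card_lt_of_refuted (H := H.image (Finset.image σ)) ?_
    (fun h => hH (h.of_image σ.injective)) hr fun r hr => ?_
  · intro t ht
    obtain ⟨t, ht', rfl⟩ := Finset.mem_image.1 ht
    rw [Finset.card_image_of_injective _ σ.injective, h3 t ht']
  · rcases hreq r hr with ⟨h1, h2⟩ | ⟨h1, h2⟩ | ⟨h1, h2⟩
    · refine ⟨6, by decide, by decide, h1, h2.trans (hle 6 _ ?_ ?_)⟩
      · exact (Finset.filter_subset _ _).trans (Finset.filter_subset _ _)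
      · intro t ht i hi
        simp only [Finset.mem_filter] at ht
        exact h6 i (fun h => ht.1.2 (h ▸ hi)) (fun h => ht.2 (h ▸ hi))
    · refine ⟨7, by decide, by decide, h1, h2.trans (hle 7 _ (Finset.filter_subset _ _) ?_)⟩
      intro t ht i hi
      simp only [Finset.mem_filter] at ht
      exact h7 i (fun h => ht.2 (h ▸ hi))
    · exact ⟨8, by decide, by decide, h1, h2.trans (hle 8 _ subset_rfl fun t _ i _ => (σ i).isLt)⟩

theorem card_le_eight {H : Finset (Finset (Fin 8))} (h3 : ∀ t ∈ H, t.card = 3)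
    (hH : ¬ HasBergeK4 H) {u v : Fin 8} (huv : u ≠ v) (hu : ∀ t ∈ H, u ∉ t)
    (hv : ∀ t ∈ H, v ∉ t) : H.card ≤ 8 := by
  by_contra! hc
  refine false_of_refuted h3 hH huv refuted_six fun r hr => Or.inl ?_
  rw [List.mem_singleton] at hr
  subst hr
  rw [Finset.filter_true_of_mem hv, Finset.filter_true_of_mem hu]
  exact ⟨rfl, hc⟩

theorem card_le_twelve {H : Finset (Finset (Fin 8))} (h3 : ∀ t ∈ H, t.card = 3)
    (hH : ¬ HasBergeK4 H) {v : Fin 8} (hv : ∀ t ∈ H, v ∉ t) : H.card ≤ 12 := by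
  by_contra! hc
  obtain ⟨G, hG, hG13⟩ := Finset.exists_subset_card_eq (Nat.succ_le_of_lt hc)
  obtain ⟨u, hu, hdeg⟩ := exists_card_mul_degree_le (S := {v}ᶜ) (H := G)
    ⟨v + 1, by simp⟩ (fun t ht => by simpa using hv t (hG ht)) fun t ht => h3 t (hG ht)
  rw [Finset.card_compl, Fintype.card_fin, Finset.card_singleton, hG13] at hdeg
  have hsum := card_filter_not_mem_add G u
  refine false_of_refuted (fun t ht => h3 t (hG ht)) (fun h => hH (h.mono hG))
    (by simpa using hu) refuted_seven fun r hr => ?_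
  rw [Finset.filter_true_of_mem fun t ht => hv t (hG ht)]
  simp only [List.mem_cons, List.not_mem_nil, or_false] at hr
  rcases hr with rfl | rfl
  · exact Or.inl ⟨rfl, by simp only; omega⟩
  · exact Or.inr (Or.inl ⟨rfl, hG13.ge⟩)

theorem card_le_eighteen {H : Finset (Finset (Fin 8))} (h3 : ∀ t ∈ H, t.card = 3)
    (hH : ¬ HasBergeK4 H) : H.card ≤ 18 := by
  by_contra! hc
  obtain ⟨G, hG, hG19⟩ := Finset.exists_subset_card_eq (Nat.succ_le_of_lt hc)
  replace h3 : ∀ t ∈ G, t.card = 3 := fun t ht => h3 t (hG ht)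
  replace hH : ¬ HasBergeK4 G := fun h => hH (h.mono hG)
  obtain ⟨v, -, hdegv⟩ := exists_card_mul_degree_le (S := Finset.univ) (H := G)
    Finset.univ_nonempty (fun t _ => Finset.subset_univ t) h3
  rw [Finset.card_univ, Fintype.card_fin, hG19] at hdegv
  have hsumv := card_filter_not_mem_add G v
  have hsub := Finset.filter_subset (v ∉ ·) G
  have h12 := card_le_twelve (fun t ht => h3 t (hsub ht)) (fun h => hH (h.mono hsub))
    fun t ht => (Finset.mem_filter.1 ht).2
  obtain ⟨u, hu, hdegu⟩ := exists_card_mul_degree_le (S := {v}ᶜ) (H := G.filter (v ∉ ·))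
    ⟨v + 1, by simp⟩ (fun t ht => by simpa using (Finset.mem_filter.1 ht).2)
    fun t ht => h3 t (hsub ht)
  rw [Finset.card_compl, Fintype.card_fin, Finset.card_singleton] at hdegu
  have hsumu := card_filter_not_mem_add (G.filter (v ∉ ·)) u
  refine false_of_refuted h3 hH (by simpa using hu) refuted_eight fun r hr => ?_
  simp only [List.mem_cons, List.not_mem_nil, or_false] at hr
  rcases hr with rfl | rfl | rfl
  · exact Or.inl ⟨rfl, by simp only; omega⟩
  · exact Or.inr (Or.inl ⟨rfl, by simp only; omega⟩)
  · exact Or.inr (Or.inr ⟨rfl, hG19.ge⟩)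

theorem card_le_of_card_le_eight {V : Type*} [DecidableEq V] [Fintype V]
    (h6 : 6 ≤ Fintype.card V) (h8 : Fintype.card V ≤ 8) {H : Finset (Finset V)}
    (h3 : ∀ t ∈ H, t.card = 3) (hH : ¬ HasBergeK4 H) :
    H.card ≤ Fintype.card V / 3 * ((Fintype.card V + 1) / 3) * ((Fintype.card V + 2) / 3) := by
  obtain ⟨n, hn⟩ : ∃ n, Fintype.card V = n := ⟨_, rfl⟩
  rw [hn] at h6 h8 ⊢
  let f : V → Fin 8 := fun x => Fin.castLE h8 (Fintype.equivFinOfCardEq hn x)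
  have hf : f.Injective := (Fin.castLE_injective h8).comp (Equiv.injective _)
  have hlt : ∀ i : Fin 8, n ≤ i.val → ∀ t ∈ H.image (Finset.image f), i ∉ t := by
    intro i hi t ht hit
    obtain ⟨t, -, rfl⟩ := Finset.mem_image.1 ht
    obtain ⟨x, -, rfl⟩ := Finset.mem_image.1 hit
    exact absurd (Fintype.equivFinOfCardEq hn x).isLt (not_lt.2 hi)
  have h3' : ∀ t ∈ H.image (Finset.image f), t.card = 3 := by
    intro t ht
    obtain ⟨t, ht', rfl⟩ := Finset.mem_image.1 ht
    rw [Finset.card_image_of_injective _ hf, h3 t ht']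
  have hH' : ¬ HasBergeK4 (H.image (Finset.image f)) := fun h => hH (h.of_image hf)
  rw [← Finset.card_image_of_injective H (Finset.image_injective hf)]
  clear_value f
  interval_cases n
  · exact card_le_eight h3' hH' (u := 6) (v := 7) (by decide) (hlt 6 (by decide))
      (hlt 7 (by decide))
  · exact card_le_twelve h3' hH' (hlt 7 (by decide))
  · exact card_le_eighteen h3' hH'

section

variable {V : Type*} [DecidableEq V]

theorem Finset.exists_injOn_of_card_le_biUnion {α β : Type*} [DecidableEq β] [Inhabited β]
    {S : Finset α} {N : α → Finset β} (h : ∀ T ⊆ S, T.card ≤ (T.biUnion N).card) :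
    ∃ f : α → β, Set.InjOn f S ∧ ∀ x ∈ S, f x ∈ N x := by
  classical
  obtain ⟨f, hf, hfN⟩ := (Finset.all_card_le_biUnion_card_iff_exists_injective
    (fun x : S => N x)).1 fun T => by
      have := h (T.map (Function.Embedding.subtype _)) fun x hx => by
        obtain ⟨y, -, rfl⟩ := Finset.mem_map.1 hx
        exact y.2
      rwa [Finset.card_map, Finset.map_eq_image, Finset.image_biUnion] at this
  refine ⟨fun x => if hx : x ∈ S then f ⟨x, hx⟩ else default, fun x hx y hy hxy => ?_,
    fun x hx => ?_⟩
  · simp only [Finset.mem_coe] at hx hy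
    simp only [dif_pos hx, dif_pos hy] at hxy
    exact congrArg Subtype.val (hf hxy)
  · simp only [dif_pos hx]
    exact hfN ⟨x, hx⟩

theorem hasBergeK4_of_injOn {H : Finset (Finset V)} {K : Finset V} (hK : K.card = 4)
    {g : Finset V → Finset V} (hg : Set.InjOn g (K.powersetCard 2))
    (hgH : ∀ p ∈ K.powersetCard 2, g p ∈ H ∧ p ⊆ g p) : HasBergeK4 H := by
  obtain ⟨a, L, haL, rfl, hL⟩ := Finset.card_eq_succ.1 hK
  obtain ⟨b, c, d, hbc, hbd, hcd, rfl⟩ := Finset.card_eq_three.1 hL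
  simp only [Finset.mem_insert, Finset.mem_singleton, not_or] at haL
  obtain ⟨hab, hac, had⟩ := haL
  have hmem : ∀ p ∈ ([{a, b}, {a, c}, {a, d}, {b, c}, {b, d}, {c, d}] : List (Finset V)),
      p ∈ Finset.powersetCard 2 {a, b, c, d} := by
    simp [Finset.mem_powersetCard, Finset.insert_subset_iff, *]
  have hnd : ([{a, b}, {a, c}, {a, d}, {b, c}, {b, d}, {c, d}] : List (Finset V)).Nodup := by
    have hne : ∀ {x y z w : V}, x ≠ z ∧ x ≠ w ∨ y ≠ z ∧ y ≠ w → ({x, y} : Finset V) ≠ {z, w} := by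
      intro x y z w h h'
      have hx : x ∈ ({z, w} : Finset V) := h' ▸ by simp
      have hy : y ∈ ({z, w} : Finset V) := h' ▸ by simp
      simp only [Finset.mem_insert, Finset.mem_singleton] at hx hy
      tauto
    simp only [List.nodup_cons, List.mem_cons, List.not_mem_nil, or_false, not_or]
    refine ⟨⟨?_, ?_, ?_, ?_, ?_⟩, ⟨?_, ?_, ?_, ?_⟩, ⟨?_, ?_, ?_⟩, ⟨?_, ?_⟩, ?_, ?_, ?_⟩ <;>
      first
      | exact hne (by grind)
      | simp
  have hnd' := hnd.map_on fun x hx y hy h => hg (hmem x hx) (hmem y hy) h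
  have hH := fun p hp => hgH p (hmem p hp)
  simp only [List.mem_cons, List.not_mem_nil, or_false, forall_eq_or_imp, forall_eq] at hH
  obtain ⟨⟨m1, s1⟩, ⟨m2, s2⟩, ⟨m3, s3⟩, ⟨m4, s4⟩, ⟨m5, s5⟩, ⟨m6, s6⟩⟩ := hH
  exact ⟨a, b, c, d, _, _, _, _, _, _, hab, hac, had, hbc, hbd, hcd, hnd', m1, m2, m3, m4, m5, m6,
    s1, s2, s3, s4, s5, s6⟩

theorem exists_decomposition_of_injOn {H : Finset (Finset V)} (hH : ¬ HasBergeK4 H)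
    (B R : Finset (Finset V)) (ψ : Finset V → Finset V) (hB : B ⊆ H) (hR : ∀ p ∈ R, p.card = 2)
    (hRB : ∀ p ∈ R, ∀ t ∈ B, ¬ p ⊆ t) (hcard : R.card + B.card = H.card) (hψ : Set.InjOn ψ R)
    (hψR : ∀ p ∈ R, ψ p ∈ H ∧ ψ p ∉ B ∧ p ⊆ ψ p) :
    ∃ B ⊆ H, ∃ R : Finset (Finset V), (∀ p ∈ R, p.card = 2) ∧ (∀ p ∈ R, ∀ t ∈ B, ¬ p ⊆ t) ∧
      R.card + B.card = H.card ∧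
      ∀ K : Finset V, K.card = 4 → ∃ p ∈ K.powersetCard 2, p ∉ R ∧ ∀ t ∈ B, ¬ p ⊆ t := by
  induction hn : B.card using Nat.strong_induction_on generalizing B R ψ with
  | _ n ih =>
  subst hn
  by_contra hcon
  have hcon' : ∃ K : Finset V, K.card = 4 ∧
      ∀ p ∈ K.powersetCard 2, p ∈ R ∨ ∃ t ∈ B, p ⊆ t := by
    by_contra! hc
    exact hcon ⟨B, hB, R, hR, hRB, hcard, hc⟩
  obtain ⟨K, hK, hKp⟩ := hcon'
  let N : Finset V → Finset (Finset V) := fun p => B.filter (p ⊆ ·)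
  let S := (K.powersetCard 2).filter fun p => (N p).Nonempty
  have hSne : ∀ p ∈ S, ∃ t ∈ B, p ⊆ t := by
    intro p hp
    obtain ⟨t, ht⟩ := (Finset.mem_filter.1 hp).2
    exact ⟨t, Finset.mem_filter.1 ht⟩
  have hSR : ∀ p ∈ S, p ∉ R := by
    intro p hp hpR
    obtain ⟨t, ht, hpt⟩ := hSne p hp
    exact hRB p hpR t ht hpt
  have hKS : ∀ p ∈ K.powersetCard 2, p ∉ S → p ∈ R := by
    intro p hp hpS
    refine (hKp p hp).resolve_right fun ⟨t, ht, hpt⟩ => hpS ?_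
    exact Finset.mem_filter.2 ⟨hp, t, Finset.mem_filter.2 ⟨ht, hpt⟩⟩
  have hinj : ∀ (T : Finset (Finset V)) (f : Finset V → Finset V), Set.InjOn f T →
      (∀ p ∈ T, f p ∈ B) → ∀ p q, (p ∉ T → p ∈ R) → (q ∉ T → q ∈ R) →
      (if p ∈ T then f p else ψ p) = (if q ∈ T then f q else ψ q) → p = q := by
    intro T f hf hfB p q hp hq h
    split_ifs at h with h1 h2 h2
    · exact hf h1 h2 h
    · exact absurd (h ▸ hfB p h1) (hψR q (hq h2)).2.1
    · exact absurd (h ▸ hfB q h2) (hψR p (hp h1)).2.1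
    · exact hψ (hp h1) (hq h2) h
  by_cases hall : ∀ T ⊆ S, T.card ≤ (T.biUnion N).card
  · obtain ⟨f, hf, hfN⟩ := Finset.exists_injOn_of_card_le_biUnion hall
    have hfB : ∀ p ∈ S, f p ∈ B ∧ p ⊆ f p := fun p hp => Finset.mem_filter.1 (hfN p hp)
    refine hH (hasBergeK4_of_injOn hK (g := fun p => if p ∈ S then f p else ψ p) ?_ ?_)
    · intro p hp q hq h
      exact hinj S f hf (fun p hp => (hfB p hp).1) p q (hKS p hp) (hKS q hq) h
    · intro p hp
      by_cases hpS : p ∈ S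
      · simp only [if_pos hpS]
        exact ⟨hB (hfB p hpS).1, (hfB p hpS).2⟩
      · simp only [if_neg hpS]
        have := hψR p (hKS p hp hpS)
        exact ⟨this.1, this.2.2⟩
  · push Not at hall
    obtain ⟨T₀, hT₀⟩ := hall
    obtain ⟨T, hT, hmin⟩ := Finset.exists_min_image
      (S.powerset.filter fun T => (T.biUnion N).card < T.card) Finset.card
      ⟨T₀, by simpa using hT₀⟩
    simp only [Finset.mem_filter, Finset.mem_powerset] at hT hmin
    obtain ⟨s, hs⟩ := Finset.card_pos.1 (Nat.zero_lt_of_lt hT.2)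
    have hle : ∀ U ⊆ T.erase s, U.card ≤ (U.biUnion N).card := by
      intro U hU
      by_contra! hc
      have h1 := hmin U ⟨hU.trans ((Finset.erase_subset _ _).trans hT.1), hc⟩
      have h2 := Finset.card_le_card hU
      have h3 := Finset.card_erase_lt_of_mem hs
      omega
    obtain ⟨f, hf, hfN⟩ := Finset.exists_injOn_of_card_le_biUnion hle
    have hXB : T.biUnion N ⊆ B := Finset.biUnion_subset.2 fun p _ => Finset.filter_subset _ _
    have hXcard : (T.biUnion N).card = (T.erase s).card := by
      have h1 := hle _ subset_rfl
      have h2 := Finset.card_le_card (Finset.biUnion_subset_biUnion_of_subset_left N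
        (Finset.erase_subset s T))
      have h3 := Finset.card_erase_add_one hs
      omega
    have hXpos : 0 < (T.biUnion N).card := by
      obtain ⟨t, ht⟩ := (Finset.mem_filter.1 (hT.1 hs)).2
      exact Finset.card_pos.2 ⟨t, Finset.mem_biUnion.2 ⟨s, hs, ht⟩⟩
    have hsub : T.erase s ⊆ S := (Finset.erase_subset _ _).trans hT.1
    have hfX : ∀ p ∈ T.erase s, f p ∈ T.biUnion N := fun p hp =>
      Finset.mem_biUnion.2 ⟨p, Finset.mem_of_mem_erase hp, hfN p hp⟩
    have hBX := Finset.card_sdiff_add_card_eq_card hXB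
    refine hcon (ih (B \ T.biUnion N).card (by omega) (B \ T.biUnion N) (R ∪ T.erase s)
      (fun p => if p ∈ T.erase s then f p else ψ p) (Finset.sdiff_subset.trans hB) ?_ ?_ ?_ ?_ ?_
      rfl)
    · intro p hp
      rcases Finset.mem_union.1 hp with hp | hp
      · exact hR p hp
      · exact (Finset.mem_powersetCard.1 (Finset.mem_filter.1 (hsub hp)).1).2
    · intro p hp t ht hpt
      rw [Finset.mem_sdiff] at ht
      rcases Finset.mem_union.1 hp with hp | hp
      · exact hRB p hp t ht.1 hpt
      · exact ht.2 (Finset.mem_biUnion.2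
          ⟨p, Finset.mem_of_mem_erase hp, Finset.mem_filter.2 ⟨ht.1, hpt⟩⟩)
    · rw [Finset.card_union_of_disjoint (Finset.disjoint_right.2 fun p hp => hSR p (hsub hp))]
      omega
    · intro p hp q hq h
      have hmem : ∀ p ∈ (↑(R ∪ T.erase s) : Set (Finset V)), p ∉ T.erase s → p ∈ R := by
        intro p hp hp'
        exact (Finset.mem_union.1 hp).resolve_right hp'
      exact hinj _ f hf (fun p hp => hXB (hfX p hp)) p q (hmem p hp) (hmem q hq) h
    · intro p hp
      by_cases hpT : p ∈ T.erase s
      · simp only [if_pos hpT]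
        exact ⟨hB (hXB (hfX p hpT)), fun h => (Finset.mem_sdiff.1 h).2 (hfX p hpT),
          (Finset.mem_filter.1 (hfN p hpT)).2⟩
      · simp only [if_neg hpT]
        have := hψR p ((Finset.mem_union.1 hp).resolve_right hpT)
        exact ⟨this.1, fun h => this.2.1 (Finset.mem_sdiff.1 h).1, this.2.2⟩

/-- The red-blue decomposition: some triples of a Berge-`K₄`-free system can be exchanged for pairs
not covered by the other triples, so that the exchanged pairs and the pairs covered by the other
triples form a `K₄`-free graph. -/
theorem exists_decomposition {H : Finset (Finset V)} (hH : ¬ HasBergeK4 H) :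
    ∃ B ⊆ H, ∃ R : Finset (Finset V), (∀ p ∈ R, p.card = 2) ∧ (∀ p ∈ R, ∀ t ∈ B, ¬ p ⊆ t) ∧
      R.card + B.card = H.card ∧
      ∀ K : Finset V, K.card = 4 → ∃ p ∈ K.powersetCard 2, p ∉ R ∧ ∀ t ∈ B, ¬ p ⊆ t :=
  exists_decomposition_of_injOn hH H ∅ id subset_rfl (by simp) (by simp) (by simp) (by simp)
    (by simp)

end

section

theorem Nat.four_mul_mul_le_add_sq (a b : ℕ) : 4 * (a * b) ≤ (a + b) ^ 2 := by
  zify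
  nlinarith [sq_nonneg ((a : ℤ) - b)]

theorem mul_le_div_three_mul {a b n : ℕ} (h : a + b ≤ n / 3 + (n + 1) / 3) :
    a * b ≤ n / 3 * ((n + 1) / 3) := by
  have h1 := (Nat.four_mul_mul_le_add_sq a b).trans (Nat.pow_le_pow_left h 2)
  obtain h2 | h2 : (n + 1) / 3 = n / 3 ∨ (n + 1) / 3 = n / 3 + 1 := by omega
  all_goals
    rw [h2] at h1 ⊢
    generalize n / 3 = x at *
    ring_nf at h1 ⊢
    omega

/-- Among all products of three naturals of sum `n`, the balanced one is largest. -/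
theorem mul_mul_le_of_add_add_eq {n a b c : ℕ} (h : a + b + c = n) :
    a * b * c ≤ n / 3 * ((n + 1) / 3) * ((n + 2) / 3) := by
  induction n generalizing a b c with
  | zero => obtain rfl : a = 0 := by omega
            simp
  | succ n ih =>
    have hstep : ∀ a b c : ℕ, a + b + (c + 1) = n + 1 →
        a + b ≤ (n + 1) / 3 + (n + 1 + 1) / 3 →
        a * b * (c + 1) ≤ (n + 1) / 3 * ((n + 1 + 1) / 3) * ((n + 1 + 2) / 3) := by
      intro a b c h h'
      have h1 := mul_le_div_three_mul h'
      have h2 := ih (a := a) (b := b) (c := c) (by omega)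
      have h3 : (n + 1 + 2) / 3 = n / 3 + 1 := by omega
      rw [h3]
      simp only [show n + 1 + 1 = n + 2 from rfl] at h1 ⊢
      linarith
    obtain hc | hc | hc : (∃ d, c = d + 1 ∧ a + b ≤ (n + 1) / 3 + (n + 1 + 1) / 3) ∨
        (∃ d, b = d + 1 ∧ a + c ≤ (n + 1) / 3 + (n + 1 + 1) / 3) ∨
        (∃ d, a = d + 1 ∧ b + c ≤ (n + 1) / 3 + (n + 1 + 1) / 3) := by
      by_cases h1 : a ≤ c ∧ b ≤ c
      · exact Or.inl ⟨c - 1, by omega, by omega⟩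
      by_cases h2 : a ≤ b ∧ c ≤ b
      · exact Or.inr (Or.inl ⟨b - 1, by omega, by omega⟩)
      · exact Or.inr (Or.inr ⟨a - 1, by omega, by omega⟩)
    · obtain ⟨d, rfl, hd⟩ := hc
      exact hstep _ _ _ h hd
    · obtain ⟨d, rfl, hd⟩ := hc
      have := hstep a c d (by omega) hd
      rwa [mul_right_comm] at this
    · obtain ⟨d, rfl, hd⟩ := hc
      have := hstep b c d (by omega) hd
      rwa [mul_comm, ← mul_assoc] at this

theorem sq_div_four (m : ℕ) : m ^ 2 / 4 = m / 2 * ((m + 1) / 2) := by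
  obtain ⟨k, rfl | rfl⟩ := Nat.even_or_odd' m
  · rw [show 2 * k / 2 = k by omega, show (2 * k + 1) / 2 = k by omega]
    ring_nf
    omega
  · rw [show (2 * k + 1) / 2 = k by omega, show (2 * k + 1 + 1) / 2 = k + 1 by omega]
    ring_nf
    omega

theorem mul_sq_div_four_le {b m : ℕ} (h : b ≤ m) : m * (b ^ 2 / 4) ≤ b * (m ^ 2 / 4) := by
  obtain rfl | h := h.eq_or_lt
  · rfl
  have hb : 4 * (b ^ 2 / 4) ≤ b ^ 2 := Nat.mul_div_le _ _
  have hm : m ^ 2 ≤ 4 * (m ^ 2 / 4) + 1 := by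
    obtain ⟨k, rfl | rfl⟩ := Nat.even_or_odd' m
    · ring_nf
      omega
    · ring_nf
      omega
  generalize b ^ 2 / 4 = p at *
  generalize m ^ 2 / 4 = q at *
  obtain ⟨d, rfl⟩ := Nat.exists_eq_add_of_lt h
  nlinarith [Nat.mul_le_mul_left (b + d + 1) hb, Nat.mul_le_mul_left b hm, Nat.zero_le (b * d),
    Nat.zero_le (b * b), Nat.zero_le (b * b * d), Nat.zero_le (b * d * d)]

theorem le_of_three_mul_le_sq {x n : ℕ} (hn : 9 ≤ n) (h : 3 * x ≤ n ^ 2) :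
    x ≤ n / 3 * ((n + 1) / 3) * ((n + 2) / 3) := by
  obtain ⟨k, rfl | rfl | rfl⟩ : ∃ k, n = 3 * k ∨ n = 3 * k + 1 ∨ n = 3 * k + 2 :=
    ⟨n / 3, by omega⟩
  · rw [show 3 * k / 3 = k by omega, show (3 * k + 1) / 3 = k by omega,
      show (3 * k + 2) / 3 = k by omega]
    have : 3 ≤ k := by omega
    nlinarith [Nat.mul_le_mul_right (k * k) this]
  · rw [show (3 * k + 1) / 3 = k by omega, show (3 * k + 1 + 1) / 3 = k by omega,
      show (3 * k + 1 + 2) / 3 = k + 1 by omega]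
    have : 3 ≤ k := by omega
    nlinarith [Nat.mul_le_mul_right (k * k) this, Nat.mul_le_mul_right k this]
  · rw [show (3 * k + 2) / 3 = k by omega, show (3 * k + 2 + 1) / 3 = k + 1 by omega,
      show (3 * k + 2 + 2) / 3 = k + 1 by omega]
    have : 3 ≤ k := by omega
    nlinarith [Nat.mul_le_mul_right (k * k) this, Nat.mul_le_mul_right k this]

theorem le_of_le_mul_add {n a b r β ρ W : ℕ} (hn : 9 ≤ n) (h : a + (b + r) = n) (ha : 1 ≤ a)
    (hβ : 4 * β ≤ b ^ 2) (hρ : 4 * (β + ρ) ≤ (b + r) ^ 2) (hW : W ≤ a * (r + β) + ρ) :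
    W ≤ n / 3 * ((n + 1) / 3) * ((n + 2) / 3) := by
  have hp : β ≤ b ^ 2 / 4 := by omega
  have hq : β + ρ ≤ (b + r) ^ 2 / 4 := by omega
  have hpq := mul_sq_div_four_le (Nat.le_add_right b r)
  have h1 : a * (b + r) + (b + r) ^ 2 / 4 ≤ n / 3 * ((n + 1) / 3) * ((n + 2) / 3) := by
    refine le_of_three_mul_le_sq hn ?_
    have : 4 * ((b + r) ^ 2 / 4) ≤ (b + r) ^ 2 := Nat.mul_div_le _ _
    generalize (b + r) ^ 2 / 4 = q at *
    subst h
    generalize b + r = m at *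
    zify at *
    nlinarith [sq_nonneg (2 * (a : ℤ) - m)]
  have h2 : a * ((b + r) ^ 2 / 4) ≤ n / 3 * ((n + 1) / 3) * ((n + 2) / 3) := by
    rw [sq_div_four, ← mul_assoc]
    exact mul_mul_le_of_add_add_eq (by omega)
  generalize n / 3 * ((n + 1) / 3) * ((n + 2) / 3) = f at *
  generalize (b + r) ^ 2 / 4 = q at *
  generalize b ^ 2 / 4 = p at *
  obtain ⟨c, rfl⟩ := Nat.exists_eq_add_of_le' ha
  have hW' : W ≤ (c + 1) * r + c * p + q := by nlinarith [Nat.mul_le_mul_left c hp]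
  obtain hm | hm := Nat.eq_zero_or_pos (b + r)
  · obtain ⟨rfl, rfl⟩ : b = 0 ∧ r = 0 := by omega
    have : β = 0 := by omega
    have : ρ = 0 := by omega
    subst β ρ
    simp_all
  · refine Nat.le_of_mul_le_mul_left ?_ hm
    calc (b + r) * W ≤ (b + r) * ((c + 1) * r + c * p + q) := Nat.mul_le_mul_left _ hW'
      _ = (b + r) * (c + 1) * r + c * ((b + r) * p) + (b + r) * q := by ring
      _ ≤ (b + r) * (c + 1) * r + c * (b * q) + (b + r) * q := by gcongr
      _ = r * ((c + 1) * (b + r) + q) + b * ((c + 1) * q) := by ring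
      _ ≤ r * f + b * f := by gcongr
      _ = (b + r) * f := by ring

end

section

variable {V : Type*} [DecidableEq V]

theorem card_le_card_mul_of_meets {F : Finset (Finset V)} {U : Finset V} {d : ℕ}
    (hF : ∀ e ∈ F, ∃ x ∈ U, x ∈ e) (hd : ∀ x ∈ U, (F.filter (x ∈ ·)).card ≤ d) :
    F.card ≤ U.card * d := by
  refine (Finset.card_le_card fun e he => ?_).trans (Finset.card_biUnion_le_card_mul U
    (fun x => F.filter (x ∈ ·)) d hd)
  obtain ⟨x, hx, hxe⟩ := hF e he
  exact Finset.mem_biUnion.2 ⟨x, hx, Finset.mem_filter.2 ⟨he, hxe⟩⟩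

theorem card_filter_mem_le_card_neighbors {E : Finset (Finset V)} {S : Finset V}
    (h2 : ∀ e ∈ E, e.card = 2) (hS : ∀ e ∈ E, e ⊆ S) (v : V) :
    (E.filter (v ∈ ·)).card ≤ (S.filter fun u => {v, u} ∈ E).card := by
  refine (Finset.card_le_card fun e he => ?_).trans
    (Finset.card_image_le (f := fun u => ({v, u} : Finset V)))
  obtain ⟨he, hv⟩ := Finset.mem_filter.1 he
  obtain ⟨u, hu⟩ := Finset.card_eq_one.1
    (by rw [Finset.card_erase_of_mem hv, h2 e he] : (e.erase v).card = 1)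
  obtain rfl : {v, u} = e := by rw [← Finset.insert_erase hv, hu]
  exact Finset.mem_image.2 ⟨u, Finset.mem_filter.2 ⟨hS _ he (by simp), he⟩, rfl⟩

/-- **Mantel's theorem** for families of pairs. -/
theorem four_mul_card_le_sq_of_triangle_free {E : Finset (Finset V)} {S : Finset V}
    (h2 : ∀ e ∈ E, e.card = 2) (hS : ∀ e ∈ E, e ⊆ S)
    (hfree : ∀ T : Finset V, T.card = 3 → ∃ p ∈ T.powersetCard 2, p ∉ E) :
    4 * E.card ≤ S.card ^ 2 := by
  obtain rfl | hne := S.eq_empty_or_nonempty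
  · have : E = ∅ := Finset.eq_empty_of_forall_notMem fun e he => by
      have h := h2 e he
      rw [Finset.subset_empty.1 (hS e he)] at h
      simp at h
    simp [this]
  obtain ⟨v, hv, hmax⟩ := S.exists_max_image (fun x => (E.filter (x ∈ ·)).card) hne
  set N := S.filter fun u => {v, u} ∈ E with hN
  have hle : E.card ≤ (S \ N).card * N.card := by
    refine card_le_card_mul_of_meets (fun e he => ?_) fun x hx =>
      (hmax x (Finset.mem_sdiff.1 hx).1).trans (card_filter_mem_le_card_neighbors h2 hS v)
    by_contra! hc
    have heN : ∀ x ∈ e, {v, x} ∈ E := fun x hx => by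
      by_contra hxE
      exact hc x (Finset.mem_sdiff.2 ⟨hS e he hx, fun h => hxE (Finset.mem_filter.1 h).2⟩) hx
    have hve : v ∉ e := fun h => by
      have := h2 _ (heN v h)
      simp at this
    obtain ⟨p, hp, hpE⟩ := hfree (insert v e) (by rw [Finset.card_insert_of_notMem hve, h2 e he])
    rw [Finset.mem_powersetCard] at hp
    by_cases hvp : v ∈ p
    · obtain ⟨u, hu⟩ := Finset.card_eq_one.1
        (by rw [Finset.card_erase_of_mem hvp, hp.2] : (p.erase v).card = 1)
      have hpu : {v, u} = p := by rw [← Finset.insert_erase hvp, hu]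
      have hup : u ∈ p.erase v := by simp [hu]
      have hue : u ∈ e := by
        have := hp.1 (Finset.mem_of_mem_erase hup)
        exact (Finset.mem_insert.1 this).resolve_left (Finset.ne_of_mem_erase hup)
      exact hpE (hpu ▸ heN u hue)
    · have : p = e := Finset.eq_of_subset_of_card_le
        ((Finset.subset_insert_iff_of_notMem hvp).1 hp.1) (by rw [hp.2, h2 e he])
      exact hpE (this ▸ he)
  have hcard := Finset.card_sdiff_add_card_eq_card (Finset.filter_subset _ _ : N ⊆ S)
  have := Nat.four_mul_mul_le_add_sq (S \ N).card N.card
  rw [hcard] at this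
  omega

/-- A family of pairs `R` and triples `B` on `n ≥ 9` points whose shadow is `K₄`-free. -/
theorem card_add_card_le_of_shadow_free [Fintype V] (hn : 9 ≤ Fintype.card V)
    {R B : Finset (Finset V)} (hR : ∀ p ∈ R, p.card = 2) (hB : ∀ t ∈ B, t.card = 3)
    (hRB : ∀ p ∈ R, ∀ t ∈ B, ¬ p ⊆ t)
    (hK : ∀ K : Finset V, K.card = 4 → ∃ p ∈ K.powersetCard 2, p ∉ R ∧ ∀ t ∈ B, ¬ p ⊆ t) :
    R.card + B.card ≤
      Fintype.card V / 3 * ((Fintype.card V + 1) / 3) * ((Fintype.card V + 2) / 3) := by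
  have hdisj : Disjoint R B := Finset.disjoint_left.2 fun p hp hp' => hRB p hp p hp' subset_rfl
  have hne : (Finset.univ : Finset V).Nonempty :=
    Finset.card_pos.1 (by rw [Finset.card_univ]; omega)
  obtain ⟨v, -, hmax⟩ := Finset.univ.exists_max_image
    (fun x : V => ((R ∪ B).filter (x ∈ ·)).card) hne
  set Nr := Finset.univ.filter fun u => {v, u} ∈ R with hNr
  set Nb := Finset.univ.filter fun u => u ≠ v ∧ ∃ t ∈ B, {v, u} ⊆ t with hNb
  have hNdisj : Disjoint Nb Nr := Finset.disjoint_left.2 fun u hb hr => by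
    obtain ⟨-, t, ht, hut⟩ := (Finset.mem_filter.1 hb).2
    exact hRB _ (Finset.mem_filter.1 hr).2 t ht hut
  have hvN : v ∉ Nb ∪ Nr := fun h => by
    rcases Finset.mem_union.1 h with h | h
    · exact (Finset.mem_filter.1 h).2.1 rfl
    · have := hR _ (Finset.mem_filter.1 h).2
      simp at this
  have hcovN : ∀ u ∈ Nb ∪ Nr, {v, u} ∈ R ∨ ∃ t ∈ B, {v, u} ⊆ t := by
    intro u hu
    rcases Finset.mem_union.1 hu with h | h
    · exact Or.inr (Finset.mem_filter.1 h).2.2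
    · exact Or.inl (Finset.mem_filter.1 h).2
  have hlink : ∀ T : Finset V, T.card = 3 → T ⊆ Nb ∪ Nr →
      ∃ p ∈ T.powersetCard 2, p ∉ R ∧ ∀ t ∈ B, ¬ p ⊆ t := by
    intro T hT hTN
    have hvT : v ∉ T := fun h => hvN (hTN h)
    obtain ⟨p, hp, hpR, hpB⟩ := hK (insert v T) (by rw [Finset.card_insert_of_notMem hvT, hT])
    rw [Finset.mem_powersetCard] at hp
    by_cases hvp : v ∈ p
    · obtain ⟨u, hu⟩ := Finset.card_eq_one.1
        (by rw [Finset.card_erase_of_mem hvp, hp.2] : (p.erase v).card = 1)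
      have hpu : {v, u} = p := by rw [← Finset.insert_erase hvp, hu]
      have hup : u ∈ p.erase v := by simp [hu]
      have huT : u ∈ T := (Finset.mem_insert.1 (hp.1 (Finset.mem_of_mem_erase hup))).resolve_left
        (Finset.ne_of_mem_erase hup)
      rcases hcovN u (hTN huT) with h | ⟨t, ht, h⟩
      · exact absurd (hpu ▸ h) hpR
      · exact absurd (hpu ▸ h) (hpB t ht)
    · exact ⟨p, Finset.mem_powersetCard.2
        ⟨(Finset.subset_insert_iff_of_notMem hvp).1 hp.1, hp.2⟩, hpR, hpB⟩
  set RN := R.filter (· ⊆ Nb ∪ Nr) with hRN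
  set L := (B.filter (v ∈ ·)).image (·.erase v) with hL
  have hLmem : ∀ p ∈ L, v ∉ p ∧ insert v p ∈ B := by
    intro p hp
    obtain ⟨t, ht, rfl⟩ := Finset.mem_image.1 hp
    rw [Finset.mem_filter] at ht
    exact ⟨Finset.notMem_erase v t, by rw [Finset.insert_erase ht.2]; exact ht.1⟩
  have hLcard : L.card = (B.filter (v ∈ ·)).card := by
    refine Finset.card_image_of_injOn fun s hs t ht h => ?_
    simp only [Finset.coe_filter, Set.mem_ofPred_eq] at hs ht
    rw [← Finset.insert_erase hs.2, ← Finset.insert_erase ht.2]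
    exact congrArg (insert v) h
  have hL2 : ∀ p ∈ L, p.card = 2 := by
    intro p hp
    have h1 := hB _ (hLmem p hp).2
    rw [Finset.card_insert_of_notMem (hLmem p hp).1] at h1
    omega
  have hLN : ∀ p ∈ L, p ⊆ Nb := by
    intro p hp u hu
    refine Finset.mem_filter.2 ⟨Finset.mem_univ u, fun h => (hLmem p hp).1 (h ▸ hu), _,
      (hLmem p hp).2, ?_⟩
    simp [Finset.insert_subset_iff, hu]
  have hLR : Disjoint L RN := Finset.disjoint_left.2 fun p hp hp' =>
    hRB p (Finset.mem_filter.1 hp').1 _ (hLmem p hp).2 (Finset.subset_insert v p)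
  have hfree : ∀ T : Finset V, T.card = 3 → ∃ p ∈ T.powersetCard 2, p ∉ L ∪ RN := by
    intro T hT
    by_contra! hc
    have hcN : ∀ p ∈ T.powersetCard 2, p ⊆ Nb ∪ Nr := by
      intro p hp
      rcases Finset.mem_union.1 (hc p hp) with h | h
      · exact (hLN p h).trans Finset.subset_union_left
      · exact (Finset.mem_filter.1 h).2
    have hTN : T ⊆ Nb ∪ Nr := by
      intro x hx
      obtain ⟨y, hy⟩ := Finset.card_pos.1
        (by rw [Finset.card_erase_of_mem hx, hT]; omega : 0 < (T.erase x).card)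
      rw [Finset.mem_erase] at hy
      refine hcN {x, y} (Finset.mem_powersetCard.2 ⟨?_, Finset.card_pair hy.1.symm⟩) (by simp)
      simp [Finset.insert_subset_iff, hx, hy.2]
    obtain ⟨p, hp, hpR, hpB⟩ := hlink T hT hTN
    rcases Finset.mem_union.1 (hc p hp) with h | h
    · exact hpB _ (hLmem p h).2 (Finset.subset_insert v p)
    · exact hpR (Finset.mem_filter.1 h).1
  have hβ : 4 * L.card ≤ Nb.card ^ 2 := four_mul_card_le_sq_of_triangle_free hL2 hLN fun T hT => by
    obtain ⟨p, hp, h⟩ := hfree T hT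
    exact ⟨p, hp, fun h' => h (Finset.mem_union_left _ h')⟩
  have hρ : 4 * (L.card + RN.card) ≤ (Nb.card + Nr.card) ^ 2 := by
    rw [← Finset.card_union_of_disjoint hLR, ← Finset.card_union_of_disjoint hNdisj]
    refine four_mul_card_le_sq_of_triangle_free (fun p hp => ?_) (fun p hp => ?_) hfree
    · rcases Finset.mem_union.1 hp with h | h
      · exact hL2 p h
      · exact hR p (Finset.mem_filter.1 h).1
    · rcases Finset.mem_union.1 hp with h | h
      · exact (hLN p h).trans Finset.subset_union_left
      · exact (Finset.mem_filter.1 h).2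
  have hdeg : ((R ∪ B).filter (v ∈ ·)).card ≤ Nr.card + L.card := by
    rw [Finset.filter_union, hLcard]
    refine (Finset.card_union_le _ _).trans (Nat.add_le_add_right ?_ _)
    exact card_filter_mem_le_card_neighbors hR (fun e _ => Finset.subset_univ e) v
  have hmeet : ((R ∪ B) \ RN).card ≤ (Nb ∪ Nr)ᶜ.card * (Nr.card + L.card) := by
    refine card_le_card_mul_of_meets (fun e he => ?_) fun x _ =>
      (Finset.card_le_card (Finset.filter_subset_filter _ Finset.sdiff_subset)).trans
        ((hmax x (Finset.mem_univ x)).trans hdeg)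
    rw [Finset.mem_sdiff] at he
    by_contra! hc
    have heN : e ⊆ Nb ∪ Nr := fun x hx => by
      by_contra h
      exact hc x (Finset.mem_compl.2 h) hx
    rcases Finset.mem_union.1 he.1 with h | h
    · exact he.2 (Finset.mem_filter.2 ⟨h, heN⟩)
    · obtain ⟨p, hp, -, hpB⟩ := hlink e (hB e h) heN
      exact hpB e h (Finset.mem_powersetCard.1 hp).1
  have hcardN := Finset.card_add_card_compl (Nb ∪ Nr)
  have hsub : RN ⊆ R ∪ B := (Finset.filter_subset _ _).trans Finset.subset_union_left
  have hcardW := Finset.card_sdiff_add_card_eq_card hsub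
  rw [Finset.card_union_of_disjoint hNdisj] at hcardN
  rw [Finset.card_union_of_disjoint hdisj] at hcardW
  exact le_of_le_mul_add hn (by omega) (Finset.card_pos.2 ⟨v, Finset.mem_compl.2 hvN⟩) hβ hρ
    (by omega)

/-- The upper bound on at least nine points. -/
theorem card_le_of_nine_le_card [Fintype V] (hn : 9 ≤ Fintype.card V) {H : Finset (Finset V)}
    (h3 : ∀ t ∈ H, t.card = 3) (hH : ¬ HasBergeK4 H) :
    H.card ≤ Fintype.card V / 3 * ((Fintype.card V + 1) / 3) * ((Fintype.card V + 2) / 3) := by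
  obtain ⟨B, hB, R, hR, hRB, hcard, hK⟩ := exists_decomposition hH
  rw [← hcard]
  exact card_add_card_le_of_shadow_free hn hR (fun t ht => h3 t (hB ht)) hRB hK

/-- The complete balanced tripartite system. -/
theorem exists_not_hasBergeK4 [Fintype V] :
    ∃ H : Finset (Finset V), (∀ t ∈ H, t.card = 3) ∧ ¬ HasBergeK4 H ∧
      H.card = Fintype.card V / 3 * ((Fintype.card V + 1) / 3) * ((Fintype.card V + 2) / 3) := by
  obtain ⟨A, -, hA⟩ := Finset.exists_subset_card_eq
    (by rw [Finset.card_univ]; omega : Fintype.card V / 3 ≤ (Finset.univ : Finset V).card)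
  obtain ⟨B, hBA, hB⟩ := Finset.exists_subset_card_eq
    (by rw [Finset.card_compl]; omega : (Fintype.card V + 1) / 3 ≤ Aᶜ.card)
  have hdAB : Disjoint A B := Finset.disjoint_left.2 fun x hx hx' =>
    Finset.mem_compl.1 (hBA hx') hx
  have hC : (A ∪ B)ᶜ.card = (Fintype.card V + 2) / 3 := by
    rw [Finset.card_compl, Finset.card_union_of_disjoint hdAB, hA, hB]
    obtain ⟨k, hk | hk | hk⟩ : ∃ k, Fintype.card V = 3 * k ∨ Fintype.card V = 3 * k + 1 ∨
        Fintype.card V = 3 * k + 2 := ⟨Fintype.card V / 3, by omega⟩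
    all_goals omega
  have hdisj : ∀ x ∈ A, x ∉ B := fun x hx hx' => Finset.disjoint_left.1 hdAB hx hx'
  let φ : V × V × V → Finset V := fun q => {q.1, q.2.1, q.2.2}
  let part : V → Fin 3 := fun x => if x ∈ A then 0 else if x ∈ B then 1 else 2
  have hpart : ∀ q ∈ A ×ˢ B ×ˢ (A ∪ B)ᶜ, part q.1 = 0 ∧ part q.2.1 = 1 ∧ part q.2.2 = 2 := by
    rintro ⟨x, y, z⟩ hq
    simp only [Finset.mem_product, Finset.mem_compl, Finset.mem_union, not_or] at hq
    have hy : y ∉ A := fun h => hdisj y h hq.2.1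
    simp [part, hq.1, hq.2.1, hq.2.2.1, hq.2.2.2, hy]
  have hinj : Set.InjOn φ ↑(A ×ˢ B ×ˢ (A ∪ B)ᶜ) := by
    rintro ⟨x, y, z⟩ hq ⟨x', y', z'⟩ hq' h
    obtain ⟨h1, h2, h3⟩ := hpart _ hq
    obtain ⟨h1', h2', h3'⟩ := hpart _ hq'
    have hx : x ∈ φ (x', y', z') := h ▸ by simp [φ]
    have hy : y ∈ φ (x', y', z') := h ▸ by simp [φ]
    have hz : z ∈ φ (x', y', z') := h ▸ by simp [φ]
    simp only [φ, Finset.mem_insert, Finset.mem_singleton] at hx hy hz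
    simp only at h1 h2 h3 h1' h2' h3'
    grind
  refine ⟨(A ×ˢ B ×ˢ (A ∪ B)ᶜ).image φ, ?_, ?_, ?_⟩
  · intro t ht
    obtain ⟨⟨x, y, z⟩, hq, rfl⟩ := Finset.mem_image.1 ht
    obtain ⟨h1, h2, h3⟩ := hpart _ hq
    simp only at h1 h2 h3
    exact Finset.card_eq_three.2 ⟨x, y, z, by grind, by grind, by grind, rfl⟩
  · have hsep : ∀ t ∈ (A ×ˢ B ×ˢ (A ∪ B)ᶜ).image φ, ∀ x y, x ≠ y → {x, y} ⊆ t →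
        part x ≠ part y := by
      intro t ht x y hxy hsub
      obtain ⟨⟨a, b, c⟩, hq, rfl⟩ := Finset.mem_image.1 ht
      obtain ⟨h1, h2, h3⟩ := hpart _ hq
      simp only [φ, Finset.insert_subset_iff, Finset.singleton_subset_iff, Finset.mem_insert,
        Finset.mem_singleton] at h1 h2 h3 hsub
      grind
    rintro ⟨a, b, c, d, e1, e2, e3, e4, e5, e6, hab, hac, had, hbc, hbd, hcd, -, m1, m2, m3, m4,
      m5, m6, s1, s2, s3, s4, s5, s6⟩
    have h1 := hsep _ m1 _ _ hab s1
    have h2 := hsep _ m2 _ _ hac s2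
    have h3 := hsep _ m3 _ _ had s3
    have h4 := hsep _ m4 _ _ hbc s4
    have h5 := hsep _ m5 _ _ hbd s5
    have h6 := hsep _ m6 _ _ hcd s6
    clear_value part
    generalize part a = a at *
    generalize part b = b at *
    generalize part c = c at *
    generalize part d = d at *
    omega
  · rw [Finset.card_image_of_injOn hinj, Finset.card_product, Finset.card_product, hA, hB, hC,
      mul_assoc]

end

/-- For every `n ≥ 6`, the maximum number of triples in a
Berge-`K₄`-free triple system on an `n`-element vertex set equals
`f n = ⌊n/3⌋ * ⌊(n+1)/3⌋ * ⌊(n+2)/3⌋`. -/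
theorem turan_bergeK4 (n : ℕ) (hn : 6 ≤ n)
    (V : Type*) [DecidableEq V] [Fintype V] (hV : Fintype.card V = n) :
    (∀ H : Finset (Finset V), (∀ t ∈ H, t.card = 3) → ¬ HasBergeK4 H →
      H.card ≤ n / 3 * ((n + 1) / 3) * ((n + 2) / 3)) ∧
    (∃ H : Finset (Finset V), (∀ t ∈ H, t.card = 3) ∧ ¬ HasBergeK4 H ∧
      H.card = n / 3 * ((n + 1) / 3) * ((n + 2) / 3)) := by
  subst hV
  refine ⟨fun H h3 hH => ?_, exists_not_hasBergeK4⟩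
  obtain h8 | h9 := Nat.lt_or_ge (Fintype.card V) 9
  · exact card_le_of_card_le_eight hn (by omega) h3 hH
  · exact card_le_of_nine_le_card h9 h3 hH
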